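/- arXiv:2209.15466 — 12 statements merged into one kernel-verified Lean document; each statement's English description precedes it below -/
import Mathlib

section
/- Let m, n ≥ 1, let Ω : ℝ^m → ℝ ∪ {+∞} be any function with Ω ≥ 0 on the non-negative orthant (no convexity assumed). Then for every a in the probability simplex △^m, every b in the probability simplex △^n, and every cost matrix C ∈ ℝ^{m×n} with non-negative entries, the dual value is at most the semi-dual value: D_Ω(a,b,C) ≤ S_Ω(a,b,C), where values are taken in the extended reals. -/
open scoped BigOperators

noncomputable section

/-- Inner product of two vectors in `ℝ^m`. -/
def dotp {m : ℕ} (s t : Fin m → ℝ) : ℝ := ∑ i, s i * t i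

/-- The conjugate `Ω₊*(s) = sup_{t ≥ 0} ⟨s,t⟩ − Ω(t)`, valued in the extended reals. -/
def conjPlus {m : ℕ} (Ω : (Fin m → ℝ) → EReal) (s : Fin m → ℝ) : EReal :=
  ⨆ t : {t : Fin m → ℝ // ∀ i, 0 ≤ t i}, ((dotp s t.1 : ℝ) : EReal) - Ω t.1

/-- The conjugate `Ω_b*(s) = sup_{t ∈ b△^m} ⟨s,t⟩ − Ω(t)`, valued in the extended reals. -/
def conjSimplex {m : ℕ} (Ω : (Fin m → ℝ) → EReal) (b : ℝ) (s : Fin m → ℝ) : EReal :=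
  ⨆ t : {t : Fin m → ℝ // (∀ i, 0 ≤ t i) ∧ ∑ i, t i = b},
    ((dotp s t.1 : ℝ) : EReal) - Ω t.1

/-- The dual value `D_Ω(a,b,C)`. -/
def dualVal {m n : ℕ} (Ω : (Fin m → ℝ) → EReal) (a : Fin m → ℝ) (b : Fin n → ℝ)
    (C : Fin m → Fin n → ℝ) : EReal :=
  ⨆ α : Fin m → ℝ, ⨆ β : Fin n → ℝ,
    ((dotp α a : ℝ) : EReal) + ((dotp β b : ℝ) : EReal)
      - ∑ j, conjPlus Ω (fun i => α i + β j - C i j)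

/-- The semi-dual value `S_Ω(a,b,C)`. -/
def semiDualVal {m n : ℕ} (Ω : (Fin m → ℝ) → EReal) (a : Fin m → ℝ) (b : Fin n → ℝ)
    (C : Fin m → Fin n → ℝ) : EReal :=
  ⨆ α : Fin m → ℝ,
    ((dotp α a : ℝ) : EReal) - ∑ j, conjSimplex Ω (b j) (fun i => α i - C i j)

/-- Restricting the supremum to the scaled simplex makes a constant shift of the argument
contribute only the constant `r * b`. -/
theorem conjSimplex_le_conjPlus_shift {m : ℕ} (Ω : (Fin m → ℝ) → EReal) (b r : ℝ)
    (s s' : Fin m → ℝ) (h : ∀ i, s' i = s i + r) :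
    conjSimplex Ω b s ≤ conjPlus Ω s' + ((-(r * b) : ℝ) : EReal) := by
  refine iSup_le fun t => ?_
  have hdot : dotp s t.1 = dotp s' t.1 + -(r * b) := by
    simp only [dotp, h, add_mul, Finset.sum_add_distrib, ← Finset.mul_sum, t.2.2]
    ring
  have hle : ((dotp s' t.1 : ℝ) : EReal) - Ω t.1 ≤ conjPlus Ω s' :=
    le_iSup (fun t : {t : Fin m → ℝ // ∀ i, 0 ≤ t i} => ((dotp s' t.1 : ℝ) : EReal) - Ω t.1)
      ⟨t.1, t.2.1⟩
  rw [hdot, EReal.coe_add, sub_eq_add_neg, add_right_comm, ← sub_eq_add_neg]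
  gcongr

theorem EReal.coe_sub_add_coe_neg (x y : ℝ) (p : EReal) :
    (x : EReal) - (p + ((-y : ℝ) : EReal)) = (x : EReal) + (y : EReal) - p := by
  induction p with
  | bot => simp [← EReal.coe_add]
  | top => simp [← EReal.coe_add, -EReal.coe_neg]
  | coe p => norm_cast; ring

/-- Weak duality: the dual value is at most the semi-dual value. -/
theorem dual_le_semiDual {m n : ℕ} (hm : 1 ≤ m) (hn : 1 ≤ n)
    (Ω : (Fin m → ℝ) → EReal)
    (hΩbot : ∀ t, Ω t ≠ ⊥)
    (hΩnonneg : ∀ t : Fin m → ℝ, (∀ i, 0 ≤ t i) → 0 ≤ Ω t)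
    (a : Fin m → ℝ) (ha : (∀ i, 0 ≤ a i) ∧ ∑ i, a i = 1)
    (b : Fin n → ℝ) (hb : (∀ j, 0 ≤ b j) ∧ ∑ j, b j = 1)
    (C : Fin m → Fin n → ℝ) (hC : ∀ i j, 0 ≤ C i j) :
    dualVal Ω a b C ≤ semiDualVal Ω a b C := by
  refine iSup_le fun α => iSup_le fun β => le_iSup_of_le α ?_
  have hsum : ∑ j, conjSimplex Ω (b j) (fun i => α i - C i j) ≤
      ∑ j, conjPlus Ω (fun i => α i + β j - C i j) + ((-dotp β b : ℝ) : EReal) := by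
    have hcoe : ((-dotp β b : ℝ) : EReal) = ∑ j, ((-(β j * b j) : ℝ) : EReal) := by
      rw [dotp, ← Finset.sum_neg_distrib]
      exact map_sum (⟨⟨Real.toEReal, EReal.coe_zero⟩, EReal.coe_add⟩ : ℝ →+ EReal) _ _
    rw [hcoe, ← Finset.sum_add_distrib]
    exact Finset.sum_le_sum fun j _ =>
      conjSimplex_le_conjPlus_shift Ω (b j) (β j) _ _ fun i => by ring
  rw [← EReal.coe_sub_add_coe_neg]
  exact EReal.sub_le_sub le_rfl hsum

end
end

section
/- Let m, n ≥ 1 and let Ω : ℝ^m → ℝ ∪ {+∞} be any function with Ω ≥ 0 on the non-negative orthant (possibly nonconvex). For every a ∈ △^m, b ∈ △^n and every C ∈ ℝ^{m×n} with non-negative entries, the dual value equals the value of the convexified primal: D_Ω(a,b,C) = inf { ⟨T,C⟩ + Σ_{j=1}^n Ω₊**(t_j) : T ∈ ℝ^{m×n}, T1_n = a, Tᵀ1_m = b }, where Ω₊** is the biconjugate of Ω + δ_{ℝ₊^m} and values are taken in the extended reals. -/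
open scoped BigOperators

noncomputable section

/-- The biconjugate `Ω₊**(t) = sup_s ⟨s,t⟩ − Ω₊*(s)`. -/
def biconjPlus {m : ℕ} (Ω : (Fin m → ℝ) → EReal) (t : Fin m → ℝ) : EReal :=
  ⨆ s : Fin m → ℝ, ((dotp s t : ℝ) : EReal) - conjPlus Ω s

/-- Any strict lower bounds of the terms summing to at most `M` forces the sum to be at most `M`. -/
theorem EReal.sum_le_of_forall_lt {ι : Type*} (s : Finset ι) (y : ι → EReal) (M : EReal)
    (h : ∀ x : ι → EReal, (∀ j ∈ s, x j < y j) → ∑ j ∈ s, x j ≤ M) : ∑ j ∈ s, y j ≤ M := by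
  classical
  induction s using Finset.induction_on generalizing M with
  | empty => simpa using h 0
  | insert i s hi ih =>
    rw [Finset.sum_insert hi]
    refine EReal.add_le_of_forall_lt fun p hp q hq => ?_
    obtain ⟨x, hx, hqx⟩ : ∃ x : ι → EReal, (∀ j ∈ s, x j < y j) ∧ q < ∑ j ∈ s, x j := by
      by_contra! hcon
      exact absurd (ih q hcon) (not_le.2 hq)
    have key := h (Function.update x i p) (by
      intro j hj
      by_cases hji : j = i
      · subst hji; simpa using hp
      · simpa [hji] using hx j (Finset.mem_of_mem_insert_of_ne hj hji))
    rw [Finset.sum_insert hi, Function.update_self, Finset.sum_update_of_notMem hi] at key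
    exact (add_le_add_right hqx.le p).trans key

theorem EReal.coe_sum {ι : Type*} (s : Finset ι) (x : ι → ℝ) :
    ((∑ j ∈ s, x j : ℝ) : EReal) = ∑ j ∈ s, (x j : EReal) := by
  classical
  induction s using Finset.induction_on with
  | empty => simp
  | insert i s hi ih => rw [Finset.sum_insert hi, Finset.sum_insert hi, EReal.coe_add, ih]

theorem EReal.sum_ne_bot {ι : Type*} (s : Finset ι) (x : ι → EReal) (h : ∀ j ∈ s, x j ≠ ⊥) :
    ∑ j ∈ s, x j ≠ ⊥ :=
  Finset.sum_induction x (· ≠ ⊥) (fun _ _ hp hq => by simp [EReal.add_eq_bot_iff, hp, hq])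
    (by simp) h

theorem EReal.sum_eq_top {ι : Type*} {s : Finset ι} {x : ι → EReal} (h : ∀ j ∈ s, x j ≠ ⊥)
    {i : ι} (hi : i ∈ s) (hx : x i = ⊤) : ∑ j ∈ s, x j = ⊤ := by
  classical
  rw [← Finset.add_sum_erase s x hi, hx]
  exact EReal.top_add_of_ne_bot
    (EReal.sum_ne_bot _ _ fun j hj => h j (Finset.mem_of_mem_erase hj))

theorem eq_zero_of_forall_mul_le {c M : ℝ} (h : ∀ x : ℝ, x * c ≤ M) : c = 0 := by
  by_contra hc
  have := h ((M + 1) / c)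
  rw [div_mul_cancel₀ _ hc] at this
  linarith

section Conjugate

variable {m : ℕ} {Ω : (Fin m → ℝ) → EReal}

theorem conjPlus_le_coe_iff (hbot : ∀ t, Ω t ≠ ⊥) (s : Fin m → ℝ) (ρ : ℝ) :
    conjPlus Ω s ≤ ρ ↔ ∀ t : Fin m → ℝ, (∀ i, 0 ≤ t i) → ∀ w : ℝ, Ω t = w → dotp s t - ρ ≤ w := by
  rw [conjPlus, iSup_le_iff]
  constructor
  · intro h t ht w hw
    have := h ⟨t, ht⟩
    simp only [hw] at this
    norm_cast at this
    linarith
  · rintro h ⟨t, ht⟩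
    rcases eq_or_ne (Ω t) ⊤ with htop | htop
    · simp [htop]
    · have hw := (EReal.coe_toReal htop (hbot t)).symm
      have := h t ht _ hw
      simp only
      rw [hw]
      norm_cast
      linarith

theorem convex_epigraph_conjPlus (hbot : ∀ t, Ω t ≠ ⊥) :
    Convex ℝ {p : (Fin m → ℝ) × ℝ | conjPlus Ω p.1 ≤ p.2} := by
  rintro ⟨s, ρ⟩ hs ⟨s', ρ'⟩ hs' p q hp hq hpq
  simp only [Set.mem_ofPred_eq, conjPlus_le_coe_iff hbot, Prod.smul_mk, Prod.mk_add_mk] at *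
  intro t ht w hw
  have h₁ := mul_le_mul_of_nonneg_left (hs t ht w hw) hp
  have h₂ := mul_le_mul_of_nonneg_left (hs' t ht w hw) hq
  have hlin : dotp (p • s + q • s') t = p * dotp s t + q * dotp s' t := by
    simp only [dotp, Pi.add_apply, Pi.smul_apply, smul_eq_mul, add_mul, Finset.sum_add_distrib,
      Finset.mul_sum, mul_assoc]
  have hw' : w = p * w + q * w := by rw [← add_mul, hpq, one_mul]
  rw [hlin, hw', smul_eq_mul, smul_eq_mul]
  linarith

theorem conjPlus_mono {s s' : Fin m → ℝ} (h : ∀ i, s i ≤ s' i) : conjPlus Ω s ≤ conjPlus Ω s' :=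
  iSup_mono fun t => EReal.sub_le_sub
    (EReal.coe_le_coe_iff.2 (Finset.sum_le_sum fun i _ =>
      mul_le_mul_of_nonneg_right (h i) (t.2 i))) le_rfl

theorem conjPlus_zero_le (hnonneg : ∀ t : Fin m → ℝ, (∀ i, 0 ≤ t i) → 0 ≤ Ω t) :
    conjPlus Ω 0 ≤ 0 :=
  iSup_le fun t => by simpa [dotp] using hnonneg t.1 t.2

theorem conjPlus_ne_bot (hbot : ∀ t, Ω t ≠ ⊥) {t : Fin m → ℝ} (ht : ∀ i, 0 ≤ t i)
    (htop : Ω t ≠ ⊤) (s : Fin m → ℝ) : conjPlus Ω s ≠ ⊥ := by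
  have h : ((dotp s t : ℝ) : EReal) - Ω t ≤ conjPlus Ω s :=
    le_iSup (fun t : {t : Fin m → ℝ // ∀ i, 0 ≤ t i} => ((dotp s t.1 : ℝ) : EReal) - Ω t.1) ⟨t, ht⟩
  rw [← EReal.coe_toReal htop (hbot t), ← EReal.coe_sub] at h
  exact ((EReal.bot_lt_coe _).trans_le h).ne'

theorem conjPlus_eq_bot (h : ∀ t : Fin m → ℝ, (∀ i, 0 ≤ t i) → Ω t = ⊤) (s : Fin m → ℝ) :
    conjPlus Ω s = ⊥ := by
  simp only [conjPlus, iSup_eq_bot]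
  rintro ⟨t, ht⟩
  simp [h t ht]

theorem biconjPlus_eq_top (h : ∀ t : Fin m → ℝ, (∀ i, 0 ≤ t i) → Ω t = ⊤) (t : Fin m → ℝ) :
    biconjPlus Ω t = ⊤ := by
  simp [biconjPlus, conjPlus_eq_bot h]

theorem coe_le_biconjPlus {s : Fin m → ℝ} {ρ : ℝ} (h : conjPlus Ω s ≤ ρ) (t : Fin m → ℝ) :
    ((dotp s t - ρ : ℝ) : EReal) ≤ biconjPlus Ω t := by
  rw [EReal.coe_sub]
  exact (EReal.sub_le_sub le_rfl h).trans
    (le_iSup (fun s : Fin m → ℝ => ((dotp s t : ℝ) : EReal) - conjPlus Ω s) s)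

theorem exists_le_of_lt_biconjPlus (hconj : ∀ s, conjPlus Ω s ≠ ⊥) {t : Fin m → ℝ} {x : EReal}
    (hx : x < biconjPlus Ω t) :
    ∃ (s : Fin m → ℝ) (ρ : ℝ), conjPlus Ω s ≤ ρ ∧ x ≤ ((dotp s t - ρ : ℝ) : EReal) := by
  obtain ⟨s, hs⟩ := lt_iSup_iff.1 hx
  have htop : conjPlus Ω s ≠ ⊤ := by
    intro h
    simp [h] at hs
  refine ⟨s, (conjPlus Ω s).toReal, EReal.le_coe_toReal htop, ?_⟩
  rw [EReal.coe_sub, EReal.coe_toReal htop (hconj s)]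
  exact hs.le

end Conjugate

section Duality

variable {m n : ℕ}

theorem weak_duality_identity {a : Fin m → ℝ} {b : Fin n → ℝ} (C T : Fin m → Fin n → ℝ)
    (hT : (∀ i, ∑ j, T i j = a i) ∧ ∀ j, ∑ i, T i j = b j) (α : Fin m → ℝ) (β : Fin n → ℝ) :
    dotp α a + dotp β b = ∑ i, ∑ j, C i j * T i j +
      ∑ j, dotp (fun i => α i + β j - C i j) (fun i => T i j) := by
  have hα : dotp α a = ∑ i, ∑ j, α i * T i j := by simp only [dotp, ← hT.1, Finset.mul_sum]
  have hβ : dotp β b = ∑ i, ∑ j, β j * T i j := by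
    simp only [dotp, ← hT.2, Finset.mul_sum]
    exact Finset.sum_comm
  rw [hα, hβ]
  simp only [dotp]
  rw [Finset.sum_comm (s := (Finset.univ : Finset (Fin n)))]
  simp only [← Finset.sum_add_distrib]
  exact Finset.sum_congr rfl fun i _ => Finset.sum_congr rfl fun j _ => by ring

/-- Lagrange multipliers for `sup ⟨α,a⟩ + ⟨β,b⟩ − ∑ ρ_j` over `α_i + β_j − C_ij ≤ S_ji`,
`(S_j, ρ_j) ∈ P`, with `P` convex. -/
theorem exists_multiplier {P : Set ((Fin m → ℝ) × ℝ)} (hP : Convex ℝ P) (h0 : (0, 0) ∈ P)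
    (a : Fin m → ℝ) (b : Fin n → ℝ) {C : Fin m → Fin n → ℝ} (hC : ∀ i j, 0 ≤ C i j) {v : ℝ}
    (hv : ∀ (α : Fin m → ℝ) (β : Fin n → ℝ) (S : Fin n → Fin m → ℝ) (ρ : Fin n → ℝ),
      (∀ j, (S j, ρ j) ∈ P) → (∀ i j, α i + β j - C i j ≤ S j i) →
        dotp α a + dotp β b - ∑ j, ρ j ≤ v) :
    ∃ T : Fin m → Fin n → ℝ,
      ∀ (α : Fin m → ℝ) (β : Fin n → ℝ) (S : Fin n → Fin m → ℝ) (ρ : Fin n → ℝ),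
        (∀ j, (S j, ρ j) ∈ P) →
          ∑ i, ∑ j, (S j i - α i - β j + C i j) * T i j + dotp α a + dotp β b - ∑ j, ρ j ≤ v := by
  let N : Set ((Fin m × Fin n → ℝ) × ℝ) := (Set.univ.pi fun _ => Set.Ioi 0) ×ˢ Set.Iio (-v)
  let Q : Set ((Fin m × Fin n → ℝ) × ℝ) :=
    {q | ∃ (α : Fin m → ℝ) (β : Fin n → ℝ) (S : Fin n → Fin m → ℝ) (ρ : Fin n → ℝ),
      (∀ j, (S j, ρ j) ∈ P) ∧
        q = (fun k => S k.2 k.1 - α k.1 - β k.2 + C k.1 k.2, ∑ j, ρ j - dotp α a - dotp β b)}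
  have hN : Convex ℝ N := (convex_pi fun _ _ => convex_Ioi _).prod (convex_Iio _)
  have hNo : IsOpen N := (isOpen_set_pi Set.finite_univ fun _ _ => isOpen_Ioi).prod isOpen_Iio
  have hQ : Convex ℝ Q := by
    rintro _ ⟨α, β, S, ρ, hS, rfl⟩ _ ⟨α', β', S', ρ', hS', rfl⟩ p q hp hq hpq
    refine ⟨p • α + q • α', p • β + q • β', p • S + q • S', p • ρ + q • ρ',
      fun j => hP (hS j) (hS' j) hp hq hpq, ?_⟩
    ext k
    · simp only [Prod.smul_mk, Prod.mk_add_mk, Pi.add_apply, Pi.smul_apply, smul_eq_mul]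
      linear_combination C k.1 k.2 * hpq
    · simp only [Prod.smul_mk, Prod.mk_add_mk, Pi.add_apply, Pi.smul_apply, smul_eq_mul, dotp,
        add_mul, Finset.sum_add_distrib, mul_assoc, ← Finset.mul_sum]
      ring
  have hdisj : Disjoint N Q := by
    rw [Set.disjoint_left]
    rintro _ ⟨hpos, hlt⟩ ⟨α, β, S, ρ, hS, rfl⟩
    simp only [Set.mem_pi, Set.mem_univ, Set.mem_Ioi, forall_const, Prod.forall] at hpos
    simp only [Set.mem_Iio] at hlt
    have := hv α β S ρ hS fun i j => by linarith [hpos i j]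
    linarith
  obtain ⟨L, u, hLN, hLQ⟩ := geometric_hahn_banach_open hN hNo hQ hdisj
  have hu : L (0, -v) ≤ u := by
    have hmem : ((0, -v) : (Fin m × Fin n → ℝ) × ℝ) ∈ closure N := by
      simp only [N, closure_prod_eq, closure_pi_set, closure_Ioi, closure_Iio]
      exact ⟨fun _ _ => Set.self_mem_Ici, Set.self_mem_Iic⟩
    exact closure_minimal (fun x hx => (hLN x hx).le)
      (isClosed_le L.continuous continuous_const) hmem
  have hsplit : ∀ (U : Fin m × Fin n → ℝ) (r : ℝ), L (U, r) = L (U, 0) + r * L (0, 1) := by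
    intro U r
    rw [← smul_eq_mul, ← map_smul, ← map_add]
    simp
  have hpos : 0 < L (0, 1) := by
    have hmem : (fun k : Fin m × Fin n => 0 - (-1) - 0 + C k.1 k.2,
        0 - dotp (fun _ => -1) a - 0) ∈ Q :=
      ⟨fun _ => -1, 0, 0, 0, fun _ => h0, by simp [dotp]⟩
    have h₁ := hLQ _ hmem
    have h₂ := hLN (fun k : Fin m × Fin n => 0 - (-1) - 0 + C k.1 k.2,
        min (-v) (0 - dotp (fun _ => -1) a - 0) - 1) (by
      refine ⟨fun k _ => ?_, ?_⟩
      · have := hC k.1 k.2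
        simp only [Set.mem_Ioi]
        linarith
      · simp only [Set.mem_Iio]
        linarith [min_le_left (-v) (0 - dotp (fun _ => -1) a - 0)])
    rw [hsplit] at h₁ h₂
    have h₃ := min_le_right (-v) (0 - dotp (fun _ => -1) a - 0)
    by_contra! hneg
    nlinarith
  have hlin : ∀ U : Fin m × Fin n → ℝ, L (U, 0) =
      ∑ i, ∑ j, U (i, j) * L (fun k => if (i, j) = k then 1 else 0, 0) := by
    intro U
    have := LinearMap.pi_apply_eq_sum_univ (L.toLinearMap ∘ₗ LinearMap.inl ℝ _ ℝ) U
    simpa [Fintype.sum_prod_type] using this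
  refine ⟨fun i j => -(L (fun k => if (i, j) = k then 1 else 0, 0)) / L (0, 1),
    fun α β S ρ hS => ?_⟩
  have hq := hu.trans (hLQ _ ⟨α, β, S, ρ, hS, rfl⟩)
  rw [hsplit, hsplit (fun k : Fin m × Fin n => S k.2 k.1 - α k.1 - β k.2 + C k.1 k.2),
    hlin (fun k : Fin m × Fin n => S k.2 k.1 - α k.1 - β k.2 + C k.1 k.2),
    show L (0, 0) = 0 from map_zero L] at hq
  simp only [mul_div_assoc', ← Finset.sum_div, mul_neg, Finset.sum_neg_distrib]
  rw [← sub_nonneg]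
  refine nonneg_of_mul_nonneg_left ?_ hpos
  have hne := hpos.ne'
  field_simp
  linarith

theorem marginals_of_multiplier {a : Fin m → ℝ} {b : Fin n → ℝ} {T : Fin m → Fin n → ℝ} {M : ℝ}
    (h : ∀ (α : Fin m → ℝ) (β : Fin n → ℝ),
      ∑ i, ∑ j, (-α i - β j) * T i j + dotp α a + dotp β b ≤ M) :
    (∀ i, ∑ j, T i j = a i) ∧ ∀ j, ∑ i, T i j = b j := by
  have hform : ∀ (α : Fin m → ℝ) (β : Fin n → ℝ),
      ∑ i, ∑ j, (-α i - β j) * T i j + dotp α a + dotp β b =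
        ∑ i, α i * (a i - ∑ j, T i j) + ∑ j, β j * (b j - ∑ i, T i j) := by
    intro α β
    simp only [sub_mul, neg_mul, Finset.sum_sub_distrib, Finset.sum_neg_distrib, mul_sub, dotp,
      Finset.mul_sum]
    rw [Finset.sum_comm (f := fun i j => β j * T i j)]
    ring
  simp only [hform] at h
  constructor
  · intro i
    have := eq_zero_of_forall_mul_le (c := a i - ∑ j, T i j) (M := M) fun x => by
      simpa [Pi.single_apply] using h (Pi.single i x) 0
    linarith
  · intro j
    have := eq_zero_of_forall_mul_le (c := b j - ∑ i, T i j) (M := M) fun x => by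
      simpa [Pi.single_apply] using h 0 (Pi.single j x)
    linarith

theorem dualVal_le_convexified_primal (hn : 1 ≤ n) {Ω : (Fin m → ℝ) → EReal}
    (hbot : ∀ t, Ω t ≠ ⊥) (a : Fin m → ℝ) (b : Fin n → ℝ) (C T : Fin m → Fin n → ℝ)
    (hT : (∀ i, ∑ j, T i j = a i) ∧ ∀ j, ∑ i, T i j = b j) :
    dualVal Ω a b C ≤
      ((∑ i, ∑ j, C i j * T i j : ℝ) : EReal) + ∑ j, biconjPlus Ω (fun i => T i j) := by
  by_cases hΩ : ∀ t : Fin m → ℝ, (∀ i, 0 ≤ t i) → Ω t = ⊤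
  · rw [EReal.sum_eq_top (x := fun j => biconjPlus Ω fun i => T i j)
      (fun j _ => by simp [biconjPlus_eq_top hΩ])
      (Finset.mem_univ (⟨0, hn⟩ : Fin n)) (biconjPlus_eq_top hΩ _), EReal.coe_add_top]
    exact le_top
  push Not at hΩ
  obtain ⟨t, ht, htop⟩ := hΩ
  have hconj := conjPlus_ne_bot hbot ht htop
  refine iSup_le fun α => iSup_le fun β => ?_
  by_cases hfin : ∃ j, conjPlus Ω (fun i => α i + β j - C i j) = ⊤
  · obtain ⟨j, hj⟩ := hfin
    rw [EReal.sum_eq_top (x := fun j => conjPlus Ω fun i => α i + β j - C i j)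
      (fun j _ => hconj _) (Finset.mem_univ j) hj, EReal.sub_top]
    exact bot_le
  push Not at hfin
  have hcoe := fun j => EReal.coe_toReal (hfin j) (hconj _)
  calc ((dotp α a : ℝ) : EReal) + ((dotp β b : ℝ) : EReal)
        - ∑ j, conjPlus Ω (fun i => α i + β j - C i j)
      = ((∑ i, ∑ j, C i j * T i j : ℝ) : EReal) +
          ∑ j, ((dotp (fun i => α i + β j - C i j) (fun i => T i j)
            - (conjPlus Ω (fun i => α i + β j - C i j)).toReal : ℝ) : EReal) := by
        rw [← EReal.coe_sum, ← Finset.sum_congr rfl fun j _ => hcoe j, ← EReal.coe_sum,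
          ← EReal.coe_add, ← EReal.coe_sub, ← EReal.coe_add, weak_duality_identity C T hT α β,
          Finset.sum_sub_distrib, add_sub_assoc]
    _ ≤ _ := add_le_add_right (Finset.sum_le_sum fun j _ =>
        coe_le_biconjPlus (hcoe j).ge _) _

theorem exists_convexified_primal_le_dualVal {Ω : (Fin m → ℝ) → EReal}
    (hbot : ∀ t, Ω t ≠ ⊥) (hnonneg : ∀ t : Fin m → ℝ, (∀ i, 0 ≤ t i) → 0 ≤ Ω t)
    (hconj : ∀ s, conjPlus Ω s ≠ ⊥) (a : Fin m → ℝ) (b : Fin n → ℝ) {C : Fin m → Fin n → ℝ}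
    (hC : ∀ i j, 0 ≤ C i j) {v : ℝ} (hv : dualVal Ω a b C ≤ v) :
    ∃ T : Fin m → Fin n → ℝ, ((∀ i, ∑ j, T i j = a i) ∧ ∀ j, ∑ i, T i j = b j) ∧
      ((∑ i, ∑ j, C i j * T i j : ℝ) : EReal) + ∑ j, biconjPlus Ω (fun i => T i j) ≤ v := by
  have h0 : ((0, 0) : (Fin m → ℝ) × ℝ) ∈ {p : (Fin m → ℝ) × ℝ | conjPlus Ω p.1 ≤ p.2} :=
    conjPlus_zero_le hnonneg
  obtain ⟨T, hT⟩ := exists_multiplier (convex_epigraph_conjPlus hbot) h0 a b hC (v := v) (by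
    intro α β S ρ hS hle
    have hsum : ∑ j, conjPlus Ω (fun i => α i + β j - C i j) ≤ ((∑ j, ρ j : ℝ) : EReal) := by
      rw [EReal.coe_sum]
      exact Finset.sum_le_sum fun j _ => (conjPlus_mono fun i => hle i j).trans (hS j)
    have hdual : ((dotp α a : ℝ) : EReal) + ((dotp β b : ℝ) : EReal)
        - ∑ j, conjPlus Ω (fun i => α i + β j - C i j) ≤ v :=
      le_trans (le_iSup₂_of_le (f := fun (α : Fin m → ℝ) (β : Fin n → ℝ) =>
        ((dotp α a : ℝ) : EReal) + ((dotp β b : ℝ) : EReal)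
          - ∑ j, conjPlus Ω (fun i => α i + β j - C i j)) α β le_rfl) hv
    exact_mod_cast (EReal.sub_le_sub le_rfl hsum).trans hdual)
  have hmarg := marginals_of_multiplier (a := a) (b := b) (T := T)
    (M := v - ∑ i, ∑ j, C i j * T i j) fun α β => by
      have := hT α β 0 0 fun _ => h0
      simp only [add_mul, Finset.sum_add_distrib, Pi.zero_apply, zero_sub,
        Finset.sum_const_zero] at this
      linarith
  refine ⟨T, hmarg, ?_⟩
  rw [add_comm, ← EReal.le_sub_iff_add_le (by simp) (by simp)]
  refine EReal.sum_le_of_forall_lt _ _ _ fun x hx => ?_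
  choose S ρ hS hxS using fun j => exists_le_of_lt_biconjPlus hconj (hx j (Finset.mem_univ j))
  refine (Finset.sum_le_sum fun j _ => hxS j).trans ?_
  rw [← EReal.coe_sum, ← EReal.coe_sub, EReal.coe_le_coe_iff]
  have := hT 0 0 S ρ hS
  simp only [Pi.zero_apply, sub_zero, add_mul, Finset.sum_add_distrib, dotp, zero_mul,
    Finset.sum_const_zero, add_zero] at this
  rw [Finset.sum_comm (f := fun i j => S j i * T i j)] at this
  simp only [dotp, Finset.sum_sub_distrib]
  linarith

end Duality

/-- Primal interpretation of the dual: `D_Ω(a,b,C)` equals the value of the convexified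
primal, an infimum over matrices satisfying both marginal constraints (no sign constraint),
with the regularizer replaced by the biconjugate `Ω₊**`. -/
theorem dual_eq_convexified_primal {m n : ℕ} (hm : 1 ≤ m) (hn : 1 ≤ n)
    (Ω : (Fin m → ℝ) → EReal)
    (hΩbot : ∀ t, Ω t ≠ ⊥)
    (hΩnonneg : ∀ t : Fin m → ℝ, (∀ i, 0 ≤ t i) → 0 ≤ Ω t)
    (a : Fin m → ℝ) (ha : (∀ i, 0 ≤ a i) ∧ ∑ i, a i = 1)
    (b : Fin n → ℝ) (hb : (∀ j, 0 ≤ b j) ∧ ∑ j, b j = 1)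
    (C : Fin m → Fin n → ℝ) (hC : ∀ i j, 0 ≤ C i j) :
    dualVal Ω a b C =
      ⨅ T : {T : Fin m → Fin n → ℝ //
          (∀ i, ∑ j, T i j = a i) ∧ (∀ j, ∑ i, T i j = b j)},
        ((∑ i, ∑ j, C i j * T.1 i j : ℝ) : EReal) + ∑ j, biconjPlus Ω (fun i => T.1 i j) := by
  refine le_antisymm (le_iInf fun T => dualVal_le_convexified_primal hn hΩbot a b C T.1 T.2) ?_
  by_cases hΩ : ∀ t : Fin m → ℝ, (∀ i, 0 ≤ t i) → Ω t = ⊤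
  · have htop : dualVal Ω a b C = ⊤ := by
      refine top_le_iff.1 (le_iSup₂_of_le 0 0 ?_)
      have hsum : ∑ j, conjPlus Ω (fun i => (0 : Fin m → ℝ) i + (0 : Fin n → ℝ) j - C i j) = ⊥ := by
        rw [← Finset.add_sum_erase _ _ (Finset.mem_univ (⟨0, hn⟩ : Fin n)), conjPlus_eq_bot hΩ,
          EReal.bot_add]
      rw [hsum, ← EReal.coe_add, EReal.coe_sub_bot]
    exact htop ▸ le_top
  push Not at hΩ
  obtain ⟨t, ht, htop⟩ := hΩ
  refine EReal.le_of_forall_lt_iff_le.1 fun v hv => ?_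
  obtain ⟨T, hT, hle⟩ := exists_convexified_primal_le_dualVal hΩbot hΩnonneg
    (conjPlus_ne_bot hΩbot ht htop) a b hC hv.le
  exact iInf_le_of_le ⟨T, hT⟩ hle

end
end

section
/- Let m ≥ 1 and 1 ≤ k ≤ m. For every s ∈ ℝ^m, the maximum of ⟨s,t⟩ − ½‖t‖₂² over all t ∈ ℝ^m with t ≥ 0 componentwise and at most k nonzero entries equals ½ times the sum of the k largest values among ([s_1]₊², …, [s_m]₊²); equivalently, sup_{t ∈ ℝ₊^m ∩ B_k} ⟨s,t⟩ − ½‖t‖₂² = ½ · max_{A ⊆ Fin m, |A| = k} Σ_{i ∈ A} [s_i]₊². -/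
open scoped BigOperators Classical

noncomputable section

/-- The sum of the `k` largest entries of a vector `u ∈ ℝ^m` (for `k ≤ m`):
the maximum over all subsets `A ⊆ Fin m` of cardinality `k` of `Σ_{i ∈ A} u i`. -/
def kLargestSum {m : ℕ} (k : ℕ) (hkm : k ≤ m) (u : Fin m → ℝ) : ℝ :=
  (Finset.powersetCard k (Finset.univ : Finset (Fin m))).sup'
    (Finset.powersetCard_nonempty.mpr (by simpa using hkm))
    (fun A => ∑ i ∈ A, u i)

/-- Each coordinate satisfies the Fenchel–Young inequality for `½ x²` on the half-line. -/
theorem mul_sub_half_sq_le_half_max_sq (a : ℝ) {x : ℝ} (hx : 0 ≤ x) :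
    a * x - (1 / 2) * x ^ 2 ≤ (1 / 2) * (max a 0) ^ 2 := by
  nlinarith [sq_nonneg (max a 0 - x), mul_le_mul_of_nonneg_right (le_max_left a 0) hx]

/-- Equality in the Fenchel–Young inequality is attained at the positive part. -/
theorem mul_max_sub_half_sq (a : ℝ) :
    a * max a 0 - (1 / 2) * (max a 0) ^ 2 = (1 / 2) * (max a 0) ^ 2 := by
  rcases le_total a 0 with h | h
  · simp [max_eq_right h]
  · rw [max_eq_left h]; ring

/-- The maximum of `⟨s,t⟩ − ½‖t‖₂²` over non-negative `k`-sparse vectors `t` equals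
half the sum of the `k` largest values among `([s_1]₊², …, [s_m]₊²)`. -/
theorem conjPlus_sparsity_constrained {m k : ℕ} (hm : 1 ≤ m) (hk : 1 ≤ k) (hkm : k ≤ m)
    (s : Fin m → ℝ) :
    IsGreatest
      {v : ℝ | ∃ t : Fin m → ℝ, (∀ i, 0 ≤ t i) ∧
        (Finset.univ.filter (fun i => t i ≠ 0)).card ≤ k ∧
        v = ∑ i, s i * t i - (1 / 2) * ∑ i, (t i) ^ 2}
      ((1 / 2) * kLargestSum k hkm (fun i => (max (s i) 0) ^ 2)) := by
  constructor
  · obtain ⟨A, hA, hsum⟩ := Finset.exists_mem_eq_sup'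
      (s := Finset.powersetCard k (Finset.univ : Finset (Fin m)))
      (Finset.powersetCard_nonempty.mpr (by simpa using hkm))
      (fun A : Finset (Fin m) => ∑ i ∈ A, (max (s i) 0) ^ 2)
    refine ⟨fun i => if i ∈ A then max (s i) 0 else 0, fun i => ?_, ?_, ?_⟩
    · dsimp only
      split_ifs
      exacts [le_max_right _ _, le_rfl]
    · rw [← (Finset.mem_powersetCard.mp hA).2]
      refine Finset.card_le_card fun i hi => ?_
      by_contra hiA
      simp [hiA] at hi
    · rw [kLargestSum, hsum, Finset.mul_sum, Finset.mul_sum, ← Finset.sum_sub_distrib,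
        ← Finset.sum_subset (Finset.subset_univ A) fun i _ hi => by simp [hi]]
      refine Finset.sum_congr rfl fun i hi => ?_
      simpa only [if_pos hi] using (mul_max_sub_half_sq (s i)).symm
  · rintro v ⟨t, ht, hcard, rfl⟩
    obtain ⟨A, hsub, -, hA⟩ := Finset.exists_subsuperset_card_eq
      (Finset.subset_univ (Finset.univ.filter (fun i => t i ≠ 0))) hcard (by simpa using hkm)
    have hle : ∑ i ∈ A, (max (s i) 0) ^ 2 ≤ kLargestSum k hkm (fun i => (max (s i) 0) ^ 2) :=
      Finset.le_sup' (fun A : Finset (Fin m) => ∑ i ∈ A, (max (s i) 0) ^ 2)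
        (Finset.mem_powersetCard.mpr ⟨Finset.subset_univ A, hA⟩)
    have hzero : ∀ i ∉ A, t i = 0 := fun i hi => by
      by_contra h
      exact hi (hsub (by simp [h]))
    calc ∑ i, s i * t i - (1 / 2) * ∑ i, (t i) ^ 2
        = ∑ i ∈ A, (s i * t i - (1 / 2) * (t i) ^ 2) := by
          rw [Finset.mul_sum, ← Finset.sum_sub_distrib]
          exact (Finset.sum_subset (Finset.subset_univ A) fun i _ hi => by
            simp [hzero i hi]).symm
      _ ≤ ∑ i ∈ A, (1 / 2) * (max (s i) 0) ^ 2 :=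
          Finset.sum_le_sum fun i _ => mul_sub_half_sq_le_half_max_sq (s i) (ht i)
      _ = (1 / 2) * ∑ i ∈ A, (max (s i) 0) ^ 2 := (Finset.mul_sum _ _ _).symm
      _ ≤ _ := by gcongr

end
end

section
/- Let m ≥ 1, 1 ≤ k ≤ m and b > 0. Let s ∈ ℝ^m have pairwise distinct entries, let A ⊆ Fin m be the set of indices of the k largest entries of s, and let τ ∈ ℝ satisfy Σ_{i ∈ A} [s_i − τ]₊ = b. Then the maximum of ⟨s,t⟩ − ½‖t‖₂² over all t with t ≥ 0, Σ_i t_i = b, and at most k nonzero entries equals ½ Σ_{i ∈ A, s_i ≥ τ} (s_i² − τ²). -/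
open scoped BigOperators Classical

noncomputable section

/-- Among the sets of at most `#A` indices, the sum of a nonnegative function is largest on a set
`A` on which it takes its largest values. -/
theorem sum_le_sum_of_card_le_of_dominates {ι : Type*} (g : ι → ℝ) (hg : ∀ i, 0 ≤ g i)
    (A T : Finset ι) (hcard : T.card ≤ A.card) (htop : ∀ i ∈ A, ∀ j ∉ A, g j ≤ g i) :
    ∑ i ∈ T, g i ≤ ∑ i ∈ A, g i := by
  have hdiff : (T \ A).card ≤ (A \ T).card := Finset.card_sdiff_le_card_sdiff_iff.2 hcard
  suffices h : ∑ i ∈ T \ A, g i ≤ ∑ i ∈ A \ T, g i by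
    rw [← Finset.sum_inter_add_sum_sdiff T A g, ← Finset.sum_inter_add_sum_sdiff A T g,
      Finset.inter_comm]
    gcongr
  rcases (A \ T).eq_empty_or_nonempty with he | hne
  · have : T \ A = ∅ := by simpa [he] using hdiff
    simp [this, he]
  · obtain ⟨a, ha, hmin⟩ := Finset.exists_min_image (A \ T) g hne
    calc ∑ i ∈ T \ A, g i ≤ (T \ A).card • g a :=
          Finset.sum_le_card_nsmul _ _ _ fun j hj =>
            htop a (Finset.mem_sdiff.1 ha).1 j (Finset.mem_sdiff.1 hj).2
      _ ≤ (A \ T).card • g a := nsmul_le_nsmul_left (hg a) hdiff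
      _ ≤ ∑ i ∈ A \ T, g i := Finset.card_nsmul_le_sum _ _ _ hmin

/-- The summands of the threshold formula, split into its linear and quadratic parts. -/
theorem half_sum_filter_sq_sub_sq {ι : Type*} (s : ι → ℝ) (A : Finset ι) (τ : ℝ) :
    (1 / 2) * ∑ i ∈ A.filter (fun i => τ ≤ s i), ((s i) ^ 2 - τ ^ 2) =
      ∑ i ∈ A, (τ * max (s i - τ) 0 + (1 / 2) * max (s i - τ) 0 ^ 2) := by
  rw [Finset.sum_filter, Finset.mul_sum]
  refine Finset.sum_congr rfl fun i _ => ?_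
  split_ifs with h
  · rw [max_eq_left (sub_nonneg.2 h)]
    ring
  · rw [max_eq_right (by linarith)]
    ring

/-- A nonnegative `t` satisfies `x t - t² / 2 ≤ [x]₊² / 2`. -/
theorem mul_sub_half_sq_le_half_sq_posPart (x t : ℝ) (ht : 0 ≤ t) :
    x * t - (1 / 2) * t ^ 2 ≤ (1 / 2) * max x 0 ^ 2 := by
  nlinarith [sq_nonneg (max x 0 - t), mul_le_mul_of_nonneg_right (le_max_left x 0) ht]

/-- The maximum of `⟨s,t⟩ − ½‖t‖₂²` over the `k`-sparse scaled simplex `b△^m ∩ B_k`,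
for a vector `s` with pairwise distinct entries, with `A` the set of indices of the `k`
largest entries of `s` and `τ` the threshold such that `Σ_{i ∈ A} [s_i − τ]₊ = b`,
equals `½ Σ_{i ∈ A, s_i ≥ τ} (s_i² − τ²)`. -/
theorem conjSimplex_sparsity_constrained {m k : ℕ} (hm : 1 ≤ m) (hk : 1 ≤ k) (hkm : k ≤ m)
    (b : ℝ) (hb : 0 < b)
    (s : Fin m → ℝ) (hs : Function.Injective s)
    (A : Finset (Fin m)) (hA : A.card = k)
    (hAtop : ∀ i ∈ A, ∀ j ∉ A, s j < s i)
    (τ : ℝ) (hτ : ∑ i ∈ A, max (s i - τ) 0 = b) :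
    IsGreatest
      {v : ℝ | ∃ t : Fin m → ℝ, (∀ i, 0 ≤ t i) ∧ (∑ i, t i = b) ∧
        (Finset.univ.filter (fun i => t i ≠ 0)).card ≤ k ∧
        v = ∑ i, s i * t i - (1 / 2) * ∑ i, (t i) ^ 2}
      ((1 / 2) * ∑ i ∈ A.filter (fun i => τ ≤ s i), ((s i) ^ 2 - τ ^ 2)) := by
  rw [half_sum_filter_sq_sub_sq]
  constructor
  · refine ⟨fun i => if i ∈ A then max (s i - τ) 0 else 0, fun i => ?_, ?_, ?_, ?_⟩
    · dsimp only
      split_ifs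
      · exact le_max_right _ _
      · exact le_rfl
    · simpa [← Finset.sum_filter] using hτ
    · rw [← hA]
      refine Finset.card_le_card fun i hi => ?_
      by_contra h
      simp [h] at hi
    · simp only [ite_pow, mul_ite, mul_zero, ne_eq, OfNat.ofNat_ne_zero, not_false_eq_true,
        zero_pow, Finset.sum_ite_mem, Finset.univ_inter]
      rw [Finset.mul_sum, ← Finset.sum_sub_distrib]
      refine Finset.sum_congr rfl fun i _ => ?_
      rcases max_choice (s i - τ) 0 with h | h <;> rw [h] <;> ring
  · rintro v ⟨t, ht, hsum, hcard, rfl⟩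
    set T := Finset.univ.filter (fun i => t i ≠ 0) with hT
    have hlin : ∑ i, s i * t i - (1 / 2) * ∑ i, (t i) ^ 2 =
        τ * b + ∑ i ∈ T, ((s i - τ) * t i - (1 / 2) * t i ^ 2) := by
      have hsupp : ∑ i ∈ T, ((s i - τ) * t i - (1 / 2) * t i ^ 2) =
          ∑ i, ((s i - τ) * t i - (1 / 2) * t i ^ 2) :=
        Finset.sum_subset (Finset.subset_univ T) fun i _ hi => by
          have : t i = 0 := by simpa [hT] using hi
          simp [this]
      rw [hsupp, ← hsum, Finset.mul_sum, Finset.mul_sum, ← Finset.sum_sub_distrib,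
        ← Finset.sum_add_distrib]
      exact Finset.sum_congr rfl fun i _ => by ring
    have htop : ∑ i ∈ T, (1 / 2) * max (s i - τ) 0 ^ 2 ≤
        ∑ i ∈ A, (1 / 2) * max (s i - τ) 0 ^ 2 := by
      refine sum_le_sum_of_card_le_of_dominates (fun i => (1 / 2) * max (s i - τ) 0 ^ 2)
        (fun i => by positivity) A T (hA ▸ hcard) fun i hi j hj => ?_
      have := (hAtop i hi j hj).le
      gcongr
    rw [hlin, Finset.sum_add_distrib, ← Finset.mul_sum, hτ]
    gcongr
    exact (Finset.sum_le_sum fun i _ =>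
      mul_sub_half_sq_le_half_sq_posPart (s i - τ) (t i) (ht i)).trans htop

end
end

section
/- Let m ≥ 1 and 1 ≤ k ≤ m. Let s ∈ ℝ^m have pairwise distinct entries and let A ⊆ Fin m be the set of indices of the k largest entries of s. Define t* ∈ ℝ^m by t*_i = [s_i]₊ for i ∈ A and t*_i = 0 otherwise. Then t* is a maximizer of ⟨s,t⟩ − ½‖t‖₂² over {t ∈ ℝ^m : t ≥ 0, at most k nonzero entries}; equivalently, t* is a Euclidean projection of s onto ℝ₊^m ∩ B_k. -/
open scoped BigOperators Classical

noncomputable section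

/-- If `f` is at least `c ≥ 0` on `A` and at most `c` off `A`, then no set with at most as many
elements as `A` has a larger sum of `f` than `A`. -/
theorem Finset.sum_le_sum_of_card_le_of_threshold {ι : Type*} (f : ι → ℝ) {A S : Finset ι} {c : ℝ}
    (hc : 0 ≤ c) (hA : ∀ i ∈ A, c ≤ f i) (hAc : ∀ j ∉ A, f j ≤ c) (hcard : S.card ≤ A.card) :
    ∑ i ∈ S, f i ≤ ∑ i ∈ A, f i := by
  have hdiff : ((S \ A).card : ℝ) ≤ (A \ S).card :=
    mod_cast Finset.card_sdiff_le_card_sdiff_iff.2 hcard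
  have hS : ∑ i ∈ S \ A, f i ≤ (S \ A).card * c := by
    simpa using Finset.sum_le_card_nsmul (S \ A) f c
      fun j hj => hAc j (Finset.mem_sdiff.1 hj).2
  have hAS : (A \ S).card * c ≤ ∑ i ∈ A \ S, f i := by
    simpa using Finset.card_nsmul_le_sum (A \ S) f c
      fun i hi => hA i (Finset.mem_sdiff.1 hi).1
  rw [← Finset.sum_inter_add_sum_sdiff S A f, ← Finset.sum_inter_add_sum_sdiff A S f,
    Finset.inter_comm A S]
  linarith [mul_le_mul_of_nonneg_right hdiff hc]

/-- Over `y ≥ 0`, the function `x * y - y ^ 2 / 2` is at most its value at `y = max x 0`. -/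
theorem mul_sub_half_sq_le_half_posPart_sq (x : ℝ) {y : ℝ} (hy : 0 ≤ y) :
    x * y - 1 / 2 * y ^ 2 ≤ 1 / 2 * max x 0 ^ 2 := by
  nlinarith [sq_nonneg (max x 0 - y), mul_le_mul_of_nonneg_right (le_max_left x 0) hy]

/-- The `k`-sparse projection onto the non-negative orthant: for `s` with pairwise distinct
entries and `A` the set of indices of the `k` largest entries of `s`, the vector `t*` with
`t*_i = [s_i]₊` for `i ∈ A` and `t*_i = 0` otherwise maximizes `⟨s,t⟩ − ½‖t‖₂²` over
`ℝ₊^m ∩ B_k` (equivalently, it is a Euclidean projection of `s` onto `ℝ₊^m ∩ B_k`). -/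
theorem kSparse_projection_orthant {m k : ℕ} (hm : 1 ≤ m) (hk : 1 ≤ k) (hkm : k ≤ m)
    (s : Fin m → ℝ) (hs : Function.Injective s)
    (A : Finset (Fin m)) (hA : A.card = k)
    (hAtop : ∀ i ∈ A, ∀ j ∉ A, s j < s i)
    (tstar : Fin m → ℝ)
    (htstar : tstar = fun i => if i ∈ A then max (s i) 0 else 0) :
    ((∀ i, 0 ≤ tstar i) ∧ (Finset.univ.filter (fun i => tstar i ≠ 0)).card ≤ k) ∧
      ∀ t : Fin m → ℝ, (∀ i, 0 ≤ t i) →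
        (Finset.univ.filter (fun i => t i ≠ 0)).card ≤ k →
        ∑ i, s i * t i - (1 / 2) * ∑ i, (t i) ^ 2 ≤
          ∑ i, s i * tstar i - (1 / 2) * ∑ i, (tstar i) ^ 2 := by
  subst htstar
  refine ⟨⟨fun i => ?_, ?_⟩, fun t ht htk => ?_⟩
  · dsimp only
    split_ifs
    exacts [le_max_right _ _, le_rfl]
  · rw [← hA]
    refine Finset.card_le_card fun i hi => ?_
    by_contra hiA
    simp [hiA] at hi
  · let g : Fin m → ℝ := fun i => 1 / 2 * max (s i) 0 ^ 2
    have g_mono {i j : Fin m} (hij : s i ≤ s j) : g i ≤ g j := by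
      have := max_le_max_right 0 hij
      dsimp only [g]
      gcongr
    obtain ⟨i₀, hi₀, hmin⟩ := A.exists_min_image s (Finset.card_pos.1 (by omega))
    have hstar : ∑ i, s i * (if i ∈ A then max (s i) 0 else 0)
        - 1 / 2 * ∑ i, (if i ∈ A then max (s i) 0 else 0) ^ 2 = ∑ i ∈ A, g i := by
      rw [Finset.mul_sum, ← Finset.sum_sub_distrib, ← Finset.sum_subset (Finset.subset_univ A)
        fun i _ hi => by simp [hi]]
      refine Finset.sum_congr rfl fun i hi => ?_
      rcases le_total (s i) 0 with h | h <;> simp [g, hi, h]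
      ring
    rw [hstar, Finset.mul_sum, ← Finset.sum_sub_distrib]
    calc ∑ i, (s i * t i - 1 / 2 * t i ^ 2)
        = ∑ i with t i ≠ 0, (s i * t i - 1 / 2 * t i ^ 2) :=
          (Finset.sum_subset (Finset.filter_subset _ _) fun i _ hi => by
            have : t i = 0 := by simpa using hi
            simp [this]).symm
      _ ≤ ∑ i with t i ≠ 0, g i :=
          Finset.sum_le_sum fun i _ => mul_sub_half_sq_le_half_posPart_sq (s i) (ht i)
      _ ≤ ∑ i ∈ A, g i :=
          Finset.sum_le_sum_of_card_le_of_threshold g (c := g i₀) (by positivity)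
            (fun i hi => g_mono (hmin i hi)) (fun j hj => g_mono (hAtop i₀ hi₀ j hj).le)
            (htk.trans hA.ge)

end
end

section
/- Let m ≥ 1 and 1 ≤ k ≤ m, and let Ω(t) := ½‖t‖₂² + δ_{B_k}(t) (i.e., Ω(t) = ½‖t‖₂² if t has at most k nonzero entries and +∞ otherwise). Then the biconjugate of Ω + δ_{ℝ₊^m} is the squared k-support norm restricted to the non-negative orthant: for all t ∈ ℝ^m, Ω₊**(t) = Ψ(t) if t ≥ 0 componentwise, and Ω₊**(t) = +∞ otherwise. -/
open scoped BigOperators Classical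

noncomputable section

/-- The sparsity-constrained quadratic regularizer
`Ω(t) = ½‖t‖₂² + δ_{B_k}(t)`, valued in the extended reals. -/
def OmegaSparse (m k : ℕ) (t : Fin m → ℝ) : EReal :=
  if (Finset.univ.filter (fun i => t i ≠ 0)).card ≤ k then
    (((1 : ℝ) / 2 * ∑ i, (t i) ^ 2 : ℝ) : EReal)
  else ⊤

/-- The squared `k`-support norm
`Ψ(t) = ½ · inf { Σ_i t_i²/λ_i : λ ∈ ℝ^m, 0 < λ_i ≤ 1, Σ_i λ_i = k }`. -/
def Psi (m k : ℕ) (t : Fin m → ℝ) : ℝ :=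
  (1 / 2) * sInf {v : ℝ | ∃ lam : Fin m → ℝ,
    (∀ i, 0 < lam i ∧ lam i ≤ 1) ∧ (∑ i, lam i) = (k : ℝ) ∧
    v = ∑ i, (t i) ^ 2 / lam i}

lemma conjPlus_OmegaSparse_le {m k : ℕ} {s : Fin m → ℝ} {c : ℝ}
    (h : ∀ u : Fin m → ℝ, (∀ i, 0 ≤ u i) →
      (Finset.univ.filter (fun i => u i ≠ 0)).card ≤ k →
      dotp s u - 1 / 2 * ∑ i, (u i) ^ 2 ≤ c) :
    conjPlus (OmegaSparse m k) s ≤ (c : EReal) := by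
  refine iSup_le fun u => ?_
  unfold OmegaSparse
  split_ifs with hu
  · rw [← EReal.coe_sub]
    exact EReal.coe_le_coe_iff.2 (h u.1 u.2 hu)
  · simp

lemma le_conjPlus_OmegaSparse {m k : ℕ} (s : Fin m → ℝ) {u : Fin m → ℝ} (hu : ∀ i, 0 ≤ u i)
    (hcard : (Finset.univ.filter (fun i => u i ≠ 0)).card ≤ k) :
    ((dotp s u - 1 / 2 * ∑ i, (u i) ^ 2 : ℝ) : EReal) ≤ conjPlus (OmegaSparse m k) s := by
  refine le_trans (le_of_eq ?_) (le_iSup _ (⟨u, hu⟩ : {t : Fin m → ℝ // ∀ i, 0 ≤ t i}))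
  unfold OmegaSparse
  rw [if_pos hcard, ← EReal.coe_sub]

lemma le_biconjPlus {m : ℕ} {Ω : (Fin m → ℝ) → EReal} {s : Fin m → ℝ} {c : ℝ}
    (h : conjPlus Ω s ≤ (c : EReal)) (t : Fin m → ℝ) :
    ((dotp s t - c : ℝ) : EReal) ≤ biconjPlus Ω t := by
  refine le_trans ?_ (le_iSup _ s)
  rw [EReal.coe_sub]
  exact EReal.sub_le_sub le_rfl h

lemma exists_card_eq_forall_le {ι : Type*} [Fintype ι] (a : ι → ℝ) {k : ℕ}
    (hk : k ≤ Fintype.card ι) :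
    ∃ S : Finset ι, S.card = k ∧ ∀ i ∈ S, ∀ j ∉ S, a j ≤ a i := by
  have hne : (Finset.powersetCard k (Finset.univ : Finset ι)).Nonempty :=
    Finset.powersetCard_nonempty.2 (by simpa using hk)
  obtain ⟨S, hS, hmax⟩ := Finset.exists_max_image _ (fun S => ∑ i ∈ S, a i) hne
  rw [Finset.mem_powersetCard] at hS
  refine ⟨S, hS.2, fun i hi j hj => ?_⟩
  have hj' : j ∉ S.erase i := fun h => hj (Finset.mem_of_mem_erase h)
  have hpos : 0 < S.card := Finset.card_pos.2 ⟨i, hi⟩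
  have hswap := hmax (insert j (S.erase i)) (by
    rw [Finset.mem_powersetCard, Finset.card_insert_of_notMem hj', Finset.card_erase_of_mem hi]
    exact ⟨Finset.subset_univ _, by omega⟩)
  have hsum := Finset.add_sum_erase S a hi
  simp only [Finset.sum_insert hj'] at hswap
  linarith

/-- A weighted sum with weights in `[0, 1]` of total mass `k` is at most the sum of the `k`
largest terms. -/
lemma sum_mul_le_sum_of_forall_le {ι : Type*} [Fintype ι] (a lam : ι → ℝ) {k : ℕ} (hk : 1 ≤ k)
    (h0 : ∀ i, 0 ≤ lam i) (h1 : ∀ i, lam i ≤ 1)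
    (hlam : ∑ i, lam i = k) {S : Finset ι} (hcard : S.card = k)
    (hS : ∀ i ∈ S, ∀ j ∉ S, a j ≤ a i) :
    ∑ i, lam i * a i ≤ ∑ i ∈ S, a i := by
  obtain ⟨p, hp, hmin⟩ := S.exists_min_image a (Finset.card_pos.1 (by omega))
  have key : ∑ i, lam i * (a i - a p) ≤ ∑ i ∈ S, (a i - a p) := by
    rw [← Finset.sum_filter_add_sum_filter_not Finset.univ (· ∈ S),
      show Finset.univ.filter (· ∈ S) = S by ext; simp]
    have hin : ∑ i ∈ S, lam i * (a i - a p) ≤ ∑ i ∈ S, (a i - a p) :=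
      Finset.sum_le_sum fun i hi => by nlinarith [hmin i hi, h1 i]
    have hout : ∑ i ∈ Finset.univ.filter (· ∉ S), lam i * (a i - a p) ≤ 0 :=
      Finset.sum_nonpos fun i hi => by
        nlinarith [hS p hp i (Finset.mem_filter.1 hi).2, h0 i]
    linarith
  simp only [mul_sub, Finset.sum_sub_distrib, ← Finset.sum_mul, hlam, Finset.sum_const, hcard,
    nsmul_eq_mul] at key
  linarith

lemma exists_le_conjPlus_forall_weighted_sum_le {m k : ℕ} (hk : 1 ≤ k) (hkm : k ≤ m) (s : Fin m → ℝ) :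
    ∃ c : ℝ, (c : EReal) ≤ conjPlus (OmegaSparse m k) s ∧
      ∀ lam : Fin m → ℝ, (∀ i, 0 ≤ lam i) → (∀ i, lam i ≤ 1) → ∑ i, lam i = (k : ℝ) →
        1 / 2 * ∑ i, lam i * (max (s i) 0) ^ 2 ≤ c := by
  have hcardk : k ≤ Fintype.card (Fin m) := by simpa using hkm
  obtain ⟨S, hcard, hS⟩ := exists_card_eq_forall_le (fun i => (max (s i) 0) ^ 2) hcardk
  have hu : ∀ i, 0 ≤ (if i ∈ S then max (s i) 0 else 0) := fun i => by
    split_ifs <;> simp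
  refine ⟨_, le_conjPlus_OmegaSparse s hu ?_, fun lam h0 h1 hlam => ?_⟩
  · rw [← hcard]
    refine Finset.card_le_card fun i hi => ?_
    by_contra h
    simp [h] at hi
  · have hle := sum_mul_le_sum_of_forall_le _ lam hk h0 h1 hlam hcard hS
    have hval : dotp s (fun i => if i ∈ S then max (s i) 0 else 0)
        - 1 / 2 * ∑ i, (if i ∈ S then max (s i) 0 else 0) ^ 2
        = 1 / 2 * ∑ i ∈ S, (max (s i) 0) ^ 2 := by
      have hS' : ∑ i ∈ S, (max (s i) 0) ^ 2 = ∑ i, if i ∈ S then (max (s i) 0) ^ 2 else 0 := by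
        simp
      rw [hS', dotp, Finset.mul_sum, Finset.mul_sum, ← Finset.sum_sub_distrib]
      refine Finset.sum_congr rfl fun i _ => ?_
      split_ifs
      · rcases max_cases (s i) 0 with ⟨h, _⟩ | ⟨h, _⟩ <;> rw [h] <;> ring
      · ring
    rw [hval]
    linarith

lemma Psi_nonempty {m k : ℕ} (hk : 1 ≤ k) (hkm : k ≤ m) (t : Fin m → ℝ) :
    {v : ℝ | ∃ lam : Fin m → ℝ,
      (∀ i, 0 < lam i ∧ lam i ≤ 1) ∧ (∑ i, lam i) = (k : ℝ) ∧
      v = ∑ i, (t i) ^ 2 / lam i}.Nonempty := by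
  have hm : (0 : ℝ) < m := by exact_mod_cast (by omega : 0 < m)
  have hk' : (0 : ℝ) < k := by exact_mod_cast hk
  have hkm' : (k : ℝ) ≤ m := by exact_mod_cast hkm
  refine ⟨_, fun _ => (k : ℝ) / m, fun i => ⟨by positivity, (div_le_one hm).2 hkm'⟩, ?_, rfl⟩
  simp
  field_simp

lemma biconjPlus_OmegaSparse_le {m k : ℕ} (hk : 1 ≤ k) (hkm : k ≤ m) {t : Fin m → ℝ}
    (ht : ∀ i, 0 ≤ t i) : biconjPlus (OmegaSparse m k) t ≤ ((Psi m k t : ℝ) : EReal) := by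
  refine iSup_le fun s => ?_
  obtain ⟨c, hc, hlam⟩ := exists_le_conjPlus_forall_weighted_sum_le hk hkm s
  refine (EReal.sub_le_sub le_rfl hc).trans ?_
  rw [← EReal.coe_sub, EReal.coe_le_coe_iff]
  have hle : 2 * (dotp s t - c) ≤ 2 * Psi m k t := by
    unfold Psi
    rw [← mul_assoc, mul_one_div_cancel two_ne_zero, one_mul]
    refine le_csInf (Psi_nonempty hk hkm t) ?_
    rintro _ ⟨lam, hl, hsum, rfl⟩
    have h := hlam lam (fun i => (hl i).1.le) (fun i => (hl i).2) hsum
    have hdot : 2 * dotp s t ≤ ∑ i, (t i) ^ 2 / lam i + ∑ i, lam i * (max (s i) 0) ^ 2 := by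
      rw [dotp, Finset.mul_sum, ← Finset.sum_add_distrib]
      refine Finset.sum_le_sum fun i _ => ?_
      have hpos := (hl i).1
      have hst : s i * t i ≤ max (s i) 0 * t i :=
        mul_le_mul_of_nonneg_right (le_max_left _ _) (ht i)
      have hsq : (t i) ^ 2 / lam i + lam i * (max (s i) 0) ^ 2 - 2 * (max (s i) 0 * t i)
          = (t i - lam i * max (s i) 0) ^ 2 / lam i := by
        field_simp
        ring
      have : 0 ≤ (t i - lam i * max (s i) 0) ^ 2 / lam i := by positivity
      linarith
    linarith
  linarith

/-- Weights are allowed to vanish in an upper bound for `Psi`. -/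
lemma Psi_le {m k : ℕ} (hk : 1 ≤ k) (hkm : k ≤ m) {lam s : Fin m → ℝ}
    (h0 : ∀ i, 0 ≤ lam i) (h1 : ∀ i, lam i ≤ 1) (hlam : ∑ i, lam i = (k : ℝ)) :
    Psi m k (fun i => lam i * s i) ≤ 1 / 2 * ∑ i, lam i * (s i) ^ 2 := by
  have hm : (0 : ℝ) < m := by exact_mod_cast (by omega : 0 < m)
  have hk' : (0 : ℝ) < k := by exact_mod_cast hk
  have hkm' : (k : ℝ) / m ≤ 1 := (div_le_one hm).2 (by exact_mod_cast hkm)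
  have hkm0 : 0 < (k : ℝ) / m := by positivity
  have key : ∀ r : ℝ, 0 < r → r < 1 →
      r * (2 * Psi m k (fun i => lam i * s i)) ≤ ∑ i, lam i * (s i) ^ 2 := by
    intro r hr0 hr1
    have hpos : ∀ i, 0 < r * lam i + (1 - r) * (k / m) := fun i =>
      add_pos_of_nonneg_of_pos (mul_nonneg hr0.le (h0 i)) (mul_pos (by linarith) hkm0)
    have hinf : 2 * Psi m k (fun i => lam i * s i)
        ≤ ∑ i, (lam i * s i) ^ 2 / (r * lam i + (1 - r) * (k / m)) := by
      unfold Psi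
      rw [← mul_assoc, mul_one_div_cancel two_ne_zero, one_mul]
      refine csInf_le ⟨0, ?_⟩ ⟨_, fun i => ⟨hpos i, ?_⟩, ?_, rfl⟩
      · rintro _ ⟨l, hl, -, rfl⟩
        exact Finset.sum_nonneg fun i _ => div_nonneg (sq_nonneg _) (hl i).1.le
      · nlinarith [h1 i]
      · rw [Finset.sum_add_distrib, ← Finset.mul_sum, hlam]
        simp
        field_simp
        ring
    refine (mul_le_mul_of_nonneg_left hinf hr0.le).trans ?_
    rw [Finset.mul_sum]
    refine Finset.sum_le_sum fun i _ => ?_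
    rw [← mul_div_assoc, div_le_iff₀ (hpos i)]
    have : 0 ≤ lam i * (s i) ^ 2 * ((1 - r) * (k / m)) :=
      mul_nonneg (mul_nonneg (h0 i) (sq_nonneg _)) (mul_nonneg (by linarith) hkm0.le)
    nlinarith
  have hlim : Filter.Tendsto (fun r : ℝ => r * (2 * Psi m k (fun i => lam i * s i)))
      (nhdsWithin 1 (Set.Iio 1)) (nhds (1 * (2 * Psi m k (fun i => lam i * s i)))) :=
    ((continuous_id.mul continuous_const).tendsto 1).mono_left nhdsWithin_le_nhds
  have hle := le_of_tendsto hlim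
    (Filter.mem_of_superset (Ioo_mem_nhdsLT zero_lt_one) fun r hr => key r hr.1 hr.2)
  linarith

lemma exists_sum_div_max_eq {ι : Type*} [Fintype ι] {t : ι → ℝ} (ht : ∀ i, 0 ≤ t i) {k : ℕ}
    (hk : 1 ≤ k) (hcard : k ≤ (Finset.univ.filter (fun i => t i ≠ 0)).card) :
    ∃ θ : ℝ, 0 < θ ∧ ∑ i, t i / max (t i) θ = k := by
  set T := Finset.univ.filter (fun i => t i ≠ 0) with hT
  obtain ⟨p, hp, hmin⟩ := T.exists_min_image t (Finset.card_pos.1 (by omega))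
  have hp0 : 0 < t p := lt_of_le_of_ne (ht p) (Finset.mem_filter.1 hp).2.symm
  have hle : ∀ i, t i ≤ ∑ j, t j := fun i =>
    Finset.single_le_sum (fun j _ => ht j) (Finset.mem_univ i)
  have hcont : ContinuousOn (fun θ => ∑ i, t i / max (t i) θ) (Set.Icc (t p) (∑ j, t j)) := by
    refine continuousOn_finsetSum _ fun i _ => ContinuousOn.div (by fun_prop) (by fun_prop) ?_
    exact fun θ hθ => (lt_max_of_lt_right (hp0.trans_le hθ.1)).ne'
  have hlow : ∑ i, t i / max (t i) (∑ j, t j) = 1 := by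
    simp only [max_eq_right (hle _)]
    rw [← Finset.sum_div, div_self (hp0.trans_le (hle p)).ne']
  have hhigh : ∑ i, t i / max (t i) (t p) = T.card := by
    rw [Finset.cast_card, hT, Finset.sum_filter]
    refine Finset.sum_congr rfl fun i _ => ?_
    split_ifs with h
    · rw [max_eq_left (hmin i (Finset.mem_filter.2 ⟨Finset.mem_univ i, h⟩)), div_self h]
    · rw [not_not.1 h, zero_div]
  obtain ⟨θ, hθ, hsum⟩ := intermediate_value_Icc' (hle p) hcont
    (show (k : ℝ) ∈ _ from ⟨by simp only [hlow]; exact_mod_cast hk,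
      by simp only [hhigh]; exact_mod_cast hcard⟩)
  exact ⟨θ, hp0.trans_le hθ.1, hsum⟩

/-- Optimal weights `lam` and dual vector `s` for the squared `k`-support norm of `t`. -/
lemma exists_weights {m k : ℕ} (hk : 1 ≤ k) (hkm : k ≤ m) {t : Fin m → ℝ} (ht : ∀ i, 0 ≤ t i) :
    ∃ (θ : ℝ) (lam s : Fin m → ℝ), 0 ≤ θ ∧ (∀ i, 0 ≤ lam i) ∧ (∀ i, lam i ≤ 1) ∧
      ∑ i, lam i = (k : ℝ) ∧ (∀ i, θ ≤ s i) ∧ (∀ i, lam i * s i = t i) ∧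
      ∀ i, s i ≠ θ → lam i = 1 := by
  rcases le_total (Finset.univ.filter (fun i => t i ≠ 0)).card k with hcard | hcard
  · obtain ⟨S, hsub, hS⟩ := Finset.exists_superset_card_eq hcard (by simpa using hkm)
    have hmem : ∀ i, t i ≠ 0 → i ∈ S := fun i hi => hsub (by simpa using hi)
    refine ⟨0, fun i => if i ∈ S then 1 else 0, t, le_rfl, fun i => ?_, fun i => ?_, ?_, ht,
      fun i => ?_, fun i hi => if_pos (hmem i hi)⟩
    · dsimp only; split_ifs <;> norm_num
    · dsimp only; split_ifs <;> norm_num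
    · simp [hS]
    · by_cases hi : t i = 0
      · simp [hi]
      · simp [hmem i hi]
  · obtain ⟨θ, hθ, hsum⟩ := exists_sum_div_max_eq ht hk hcard
    have hpos : ∀ i, 0 < max (t i) θ := fun i => lt_max_of_lt_right hθ
    refine ⟨θ, fun i => t i / max (t i) θ, fun i => max (t i) θ, hθ.le,
      fun i => div_nonneg (ht i) (hpos i).le, fun i => (div_le_one (hpos i)).2 (le_max_left _ _),
      hsum, fun i => le_max_right _ _, fun i => div_mul_cancel₀ _ (hpos i).ne', fun i hi => ?_⟩
    have hmax : max (t i) θ = t i := (max_choice _ _).resolve_right hi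
    have := hpos i
    simp only [hmax] at this ⊢
    exact div_self this.ne'

lemma conjPlus_OmegaSparse_le_of_weights {m k : ℕ} {θ : ℝ} {lam s : Fin m → ℝ} (hθ : 0 ≤ θ)
    (hlam : ∑ i, lam i = (k : ℝ)) (hs : ∀ i, θ ≤ s i)
    (hone : ∀ i, s i ≠ θ → lam i = 1) :
    conjPlus (OmegaSparse m k) s ≤ ((1 / 2 * ∑ i, lam i * (s i) ^ 2 : ℝ) : EReal) := by
  refine conjPlus_OmegaSparse_le fun u _ hcard => ?_
  set U := Finset.univ.filter (fun i => u i ≠ 0) with hU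
  have hyoung : 2 * dotp s u - ∑ i, (u i) ^ 2 ≤ ∑ i ∈ U, (s i) ^ 2 := by
    rw [dotp, Finset.mul_sum, ← Finset.sum_sub_distrib, hU, Finset.sum_filter]
    refine Finset.sum_le_sum fun i _ => ?_
    split_ifs with h
    · nlinarith [sq_nonneg (s i - u i)]
    · simp [not_not.1 h]
  have hexcess : ∀ i, (s i) ^ 2 - θ ^ 2 = lam i * ((s i) ^ 2 - θ ^ 2) := fun i => by
    by_cases h : s i = θ
    · simp [h]
    · rw [hone i h, one_mul]
  have hsub : ∑ i ∈ U, ((s i) ^ 2 - θ ^ 2) ≤ ∑ i, lam i * ((s i) ^ 2 - θ ^ 2) := by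
    rw [← Finset.sum_congr rfl fun i _ => hexcess i]
    exact Finset.sum_le_sum_of_subset_of_nonneg (Finset.subset_univ _)
      fun i _ _ => sub_nonneg.2 (pow_le_pow_left₀ hθ (hs i) 2)
  simp only [mul_sub, Finset.sum_sub_distrib, ← Finset.sum_mul, hlam, Finset.sum_const,
    nsmul_eq_mul] at hsub
  have hU' : (U.card : ℝ) * θ ^ 2 ≤ k * θ ^ 2 :=
    mul_le_mul_of_nonneg_right (by exact_mod_cast hcard) (sq_nonneg θ)
  linarith

lemma le_biconjPlus_OmegaSparse {m k : ℕ} (hk : 1 ≤ k) (hkm : k ≤ m) {t : Fin m → ℝ}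
    (ht : ∀ i, 0 ≤ t i) : ((Psi m k t : ℝ) : EReal) ≤ biconjPlus (OmegaSparse m k) t := by
  obtain ⟨θ, lam, s, hθ, h0, h1, hlam, hs, hst, hone⟩ := exists_weights hk hkm ht
  refine le_trans ?_
    (le_biconjPlus (conjPlus_OmegaSparse_le_of_weights hθ hlam hs hone) t)
  rw [EReal.coe_le_coe_iff]
  obtain rfl : (fun i => lam i * s i) = t := funext hst
  have hdot : dotp s (fun i => lam i * s i) = ∑ i, lam i * (s i) ^ 2 :=
    Finset.sum_congr rfl fun i _ => by ring
  have := Psi_le (s := s) hk hkm h0 h1 hlam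
  linarith

lemma biconjPlus_OmegaSparse_eq_top {m k : ℕ} {t : Fin m → ℝ} {j : Fin m} (hj : t j < 0) :
    biconjPlus (OmegaSparse m k) t = ⊤ := by
  rw [EReal.eq_top_iff_forall_lt]
  intro y
  obtain ⟨n, hn⟩ := exists_nat_gt (y / -t j)
  rw [div_lt_iff₀ (neg_pos.2 hj)] at hn
  have hdot : ∀ u : Fin m → ℝ, dotp (Pi.single j (-(n : ℝ))) u = -n * u j := fun u => by
    simp [dotp, Pi.single_apply]
  have hconj : conjPlus (OmegaSparse m k) (Pi.single j (-(n : ℝ))) ≤ ((0 : ℝ) : EReal) :=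
    conjPlus_OmegaSparse_le fun u hu _ => by
      rw [hdot]
      have h1 : 0 ≤ (n : ℝ) * u j := mul_nonneg n.cast_nonneg (hu j)
      have h2 : 0 ≤ ∑ i, (u i) ^ 2 := Finset.sum_nonneg fun i _ => sq_nonneg _
      linarith
  refine lt_of_lt_of_le ?_ (le_biconjPlus hconj t)
  rw [EReal.coe_lt_coe_iff, hdot]
  linarith

/-- The biconjugate of `Ω + δ_{ℝ₊^m}`, with `Ω = ½‖·‖₂² + δ_{B_k}`, is the squared
`k`-support norm on the non-negative orthant and `+∞` outside of it. -/
theorem biconjPlus_OmegaSparse {m k : ℕ} (hm : 1 ≤ m) (hk : 1 ≤ k) (hkm : k ≤ m) :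
    ∀ t : Fin m → ℝ,
      ((∀ i, 0 ≤ t i) → biconjPlus (OmegaSparse m k) t = ((Psi m k t : ℝ) : EReal)) ∧
      (¬ (∀ i, 0 ≤ t i) → biconjPlus (OmegaSparse m k) t = ⊤) := by
  refine fun t => ⟨fun ht => ?_, fun ht => ?_⟩
  · exact le_antisymm (biconjPlus_OmegaSparse_le hk hkm ht) (le_biconjPlus_OmegaSparse hk hkm ht)
  · obtain ⟨j, hj⟩ := not_forall.1 ht
    exact biconjPlus_OmegaSparse_eq_top (not_le.1 hj)

end
end

section
/- Let m ≥ 1, 1 ≤ k ≤ m, b > 0, and let Ω(t) := ½‖t‖₂² + δ_{B_k}(t). Then the biconjugate of Ω + δ_{b△^m} is the squared k-support norm restricted to the scaled simplex: for all t ∈ ℝ^m, Ω_b**(t) = Ψ(t) if t ≥ 0 componentwise and Σ_i t_i = b, and Ω_b**(t) = +∞ otherwise. -/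
open scoped BigOperators Classical

noncomputable section

/-- The biconjugate `Ω_b**(t) = sup_s ⟨s,t⟩ − Ω_b*(s)`. -/
def biconjSimplex {m : ℕ} (Ω : (Fin m → ℝ) → EReal) (b : ℝ) (t : Fin m → ℝ) : EReal :=
  ⨆ s : Fin m → ℝ, ((dotp s t : ℝ) : EReal) - conjSimplex Ω b s

lemma conjSimplex_OmegaSparse_le {m k : ℕ} {b c : ℝ} {s : Fin m → ℝ}
    (h : ∀ u : Fin m → ℝ, (∀ i, 0 ≤ u i) → ∑ i, u i = b →
      (Finset.univ.filter (fun i => u i ≠ 0)).card ≤ k →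
      dotp s u - 1 / 2 * ∑ i, (u i) ^ 2 ≤ c) :
    conjSimplex (OmegaSparse m k) b s ≤ (c : EReal) := by
  refine iSup_le fun u => ?_
  unfold OmegaSparse
  split_ifs with hu
  · exact_mod_cast h u.1 u.2.1 u.2.2 hu
  · simp

lemma le_biconjSimplex {m : ℕ} {Ω : (Fin m → ℝ) → EReal} {b c : ℝ} (s t : Fin m → ℝ)
    (h : conjSimplex Ω b s ≤ (c : EReal)) :
    ((dotp s t - c : ℝ) : EReal) ≤ biconjSimplex Ω b t := by
  refine le_trans ?_ (le_iSup (fun s => ((dotp s t : ℝ) : EReal) - conjSimplex Ω b s) s)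
  rw [EReal.coe_sub]
  exact EReal.sub_le_sub le_rfl h

lemma biconjSimplex_le {m : ℕ} {Ω : (Fin m → ℝ) → EReal} {b c : ℝ} {t : Fin m → ℝ}
    (h : ∀ s : Fin m → ℝ, ((dotp s t - c : ℝ) : EReal) ≤ conjSimplex Ω b s) :
    biconjSimplex Ω b t ≤ (c : EReal) := by
  refine iSup_le fun s => (EReal.sub_le_sub le_rfl (h s)).trans ?_
  rw [← EReal.coe_sub, sub_sub_cancel]

lemma eq_top_of_forall_mul_le {x : EReal} {d : ℝ} (hd : 0 < d)
    (h : ∀ c : ℝ, 0 ≤ c → ((c * d : ℝ) : EReal) ≤ x) : x = ⊤ := by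
  rw [EReal.eq_top_iff_forall_lt]
  intro y
  refine lt_of_lt_of_le ?_ (h ((|y| + 1) / d) (by positivity))
  rw [div_mul_cancel₀ _ hd.ne']
  exact_mod_cast (le_abs_self y).trans_lt (lt_add_one _)

lemma biconjSimplex_OmegaSparse_eq_top {m k : ℕ} {b : ℝ} {t : Fin m → ℝ}
    (ht : ¬ ((∀ i, 0 ≤ t i) ∧ ∑ i, t i = b)) :
    biconjSimplex (OmegaSparse m k) b t = ⊤ := by
  by_cases h0 : ∀ i, 0 ≤ t i
  · have hne : ∑ i, t i - b ≠ 0 := fun h => ht ⟨h0, sub_eq_zero.mp h⟩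
    refine eq_top_of_forall_mul_le (mul_self_pos.mpr hne) fun c _ => ?_
    set d := ∑ i, t i - b with hd
    have hdot : ∀ u : Fin m → ℝ, dotp (fun _ => c * d) u = c * d * ∑ i, u i := fun u => by
      simp [dotp, Finset.mul_sum]
    have := le_biconjSimplex (Ω := OmegaSparse m k) (b := b) (c := c * d * b)
      (fun _ => c * d) t (conjSimplex_OmegaSparse_le fun u _ hu _ => by
        rw [hdot, hu]
        have : 0 ≤ ∑ i, (u i) ^ 2 := Finset.sum_nonneg fun i _ => sq_nonneg _
        linarith)
    rw [hdot] at this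
    convert this using 2
    rw [hd]; ring
  · push Not at h0
    obtain ⟨i, hi⟩ := h0
    refine eq_top_of_forall_mul_le (neg_pos.mpr hi) fun c hc => ?_
    have hdot : ∀ u : Fin m → ℝ, dotp (Pi.single i (-c)) u = -c * u i := fun u => by
      simp [dotp, Pi.single_apply]
    have := le_biconjSimplex (Ω := OmegaSparse m k) (b := b) (c := 0)
      (Pi.single i (-c)) t (conjSimplex_OmegaSparse_le fun u hu _ _ => by
        rw [hdot]
        have : 0 ≤ ∑ i, (u i) ^ 2 := Finset.sum_nonneg fun i _ => sq_nonneg _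
        nlinarith [mul_nonneg hc (hu i)])
    rw [hdot] at this
    convert this using 2
    ring

lemma exists_threshold {ι : Type*} (X Y : Finset ι) (w : ι → ℝ)
    (h : ∀ i ∈ X, ∀ j ∈ Y, w j ≤ w i) :
    ∃ c, (∀ i ∈ X, c ≤ w i) ∧ ∀ j ∈ Y, w j ≤ c := by
  rcases X.eq_empty_or_nonempty with rfl | hX
  · rcases Y.eq_empty_or_nonempty with rfl | hY
    · exact ⟨0, by simp, by simp⟩
    · obtain ⟨j, _, hj⟩ := Y.exists_max_image w hY
      exact ⟨w j, by simp, hj⟩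
  · obtain ⟨i, hi, hi'⟩ := X.exists_min_image w hX
    exact ⟨w i, hi', h i hi⟩

/-- A linear functional on the hypersimplex, evaluated at `l`, is dominated by its value at some
vertex of the smallest face containing `l`. -/
lemma exists_card_eq_sum_mul_le {ι : Type*} [Fintype ι] {k : ℕ} {l : ι → ℝ}
    (hl0 : ∀ i, 0 ≤ l i) (hl1 : ∀ i, l i ≤ 1) (hl : ∑ i, l i = k) (w : ι → ℝ) :
    ∃ S : Finset ι, S.card = k ∧ (∀ i, l i = 1 → i ∈ S) ∧ ∑ i, l i * w i ≤ ∑ i ∈ S, w i := by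
  set A := Finset.univ.filter fun i => l i = 1 with hA
  have hAk : A.card ≤ k := by
    have : ∑ i ∈ A, l i ≤ ∑ i, l i :=
      Finset.sum_le_univ_sum_of_nonneg hl0
    rw [hl, Finset.sum_congr rfl fun i hi => (Finset.mem_filter.mp hi).2] at this
    simpa using this
  have hkn : k ≤ (Finset.univ : Finset ι).card := by
    have : ∑ i, l i ≤ ∑ _i : ι, (1 : ℝ) := Finset.sum_le_sum fun i _ => hl1 i
    rw [hl] at this
    simpa using this
  obtain ⟨S₀, hAS₀, -, hS₀⟩ := Finset.exists_subsuperset_card_eq A.subset_univ hAk hkn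
  obtain ⟨S, hS, hmax⟩ :=
    (Finset.univ.filter fun S : Finset ι => A ⊆ S ∧ S.card = k).exists_max_image
      (fun S => ∑ i ∈ S, w i) ⟨S₀, by simp [hAS₀, hS₀]⟩
  obtain ⟨hAS, hSk⟩ := (Finset.mem_filter.mp hS).2
  refine ⟨S, hSk, fun i hi => hAS (by simp [hA, hi]), ?_⟩
  obtain ⟨c, hc1, hc2⟩ := exists_threshold (S \ A) Sᶜ w fun i hi j hj => by
    rw [Finset.mem_sdiff] at hi
    rw [Finset.mem_compl] at hj
    have hj' : j ∉ S.erase i := fun h => hj (Finset.mem_of_mem_erase h)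
    have := hmax (insert j (S.erase i)) (by
      simp only [Finset.mem_filter, Finset.mem_univ, true_and]
      refine ⟨fun a ha => Finset.mem_insert_of_mem (Finset.mem_erase.mpr ⟨?_, hAS ha⟩), ?_⟩
      · rintro rfl
        exact hi.2 ha
      · rw [Finset.card_insert_of_notMem hj', Finset.card_erase_add_one hi.1, hSk])
    rw [Finset.sum_insert hj', ← Finset.add_sum_erase S w hi.1] at this
    linarith
  have key : ∀ i, (l i - if i ∈ S then 1 else 0) * w i ≤ (l i - if i ∈ S then 1 else 0) * c := by
    intro i
    by_cases hi : i ∈ S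
    · by_cases hiA : i ∈ A
      · simp [hi, (Finset.mem_filter.mp hiA).2]
      · have := hc1 i (Finset.mem_sdiff.mpr ⟨hi, hiA⟩)
        simp only [hi, if_true]
        nlinarith [hl1 i]
    · have := hc2 i (Finset.mem_compl.mpr hi)
      simp only [hi, if_false, sub_zero]
      exact mul_le_mul_of_nonneg_left this (hl0 i)
  have := Finset.sum_le_sum fun i (_ : i ∈ Finset.univ) => key i
  rw [← Finset.sum_mul, Finset.sum_sub_distrib, hl] at this
  simp [sub_mul, Finset.sum_sub_distrib, hSk] at this
  exact this

/-- Optimal weights for the variational formula of the squared `k`-support norm, in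
complementary-slackness form. -/
lemma exists_optimal_weights {m k : ℕ} (hk : 1 ≤ k) (hkm : k ≤ m) {t : Fin m → ℝ}
    (ht : ∀ i, 0 ≤ t i) :
    ∃ (τ : ℝ) (l : Fin m → ℝ), 0 ≤ τ ∧ (∀ i, 0 ≤ l i) ∧ (∀ i, l i ≤ 1) ∧ ∑ i, l i = k ∧
      (∀ i, l i * max (t i) τ = t i) ∧ ∀ i, τ < max (t i) τ → l i = 1 := by
  by_cases hcard : (Finset.univ.filter fun i => t i ≠ 0).card ≤ k
  · obtain ⟨T, hT, -, hTk⟩ := Finset.exists_subsuperset_card_eq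
      (Finset.univ.filter fun i => t i ≠ 0).subset_univ hcard (by simpa using hkm)
    have hmem : ∀ i, t i ≠ 0 → i ∈ T := fun i hi => hT (by simp [hi])
    refine ⟨0, fun i => if i ∈ T then 1 else 0, le_rfl, fun i => ?_, fun i => ?_, ?_, fun i => ?_,
      fun i hi => ?_⟩
    · dsimp only; split_ifs <;> norm_num
    · dsimp only; split_ifs <;> norm_num
    · simp [hTk]
    · rw [max_eq_left (ht i)]
      by_cases h : t i = 0
      · simp [h]
      · simp [hmem i h]
    · rw [max_eq_left (ht i)] at hi
      simp [hmem i hi.ne']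
  · push Not at hcard
    obtain ⟨j, hj, hmin⟩ := (Finset.univ.filter fun i => t i ≠ 0).exists_min_image t
      (Finset.card_pos.mp (by omega))
    have hj0 : 0 < t j := lt_of_le_of_ne (ht j) (Ne.symm (by simpa using hj))
    have hle : ∀ i, t i ≤ ∑ i, t i := fun i =>
      Finset.single_le_sum (fun i _ => ht i) (Finset.mem_univ i)
    have hk1 : (1 : ℝ) ≤ k := by exact_mod_cast hk
    obtain ⟨τ, ⟨hτ, -⟩, hzero⟩ := intermediate_value_Icc' (hle j)
      (f := fun τ => ∑ i, min (t i) τ - k * τ) (by fun_prop) (show (0 : ℝ) ∈ _ by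
        constructor
        · simp only [min_eq_left (hle _)]
          nlinarith [hle j]
        · have h1 : ∑ i ∈ Finset.univ.filter (fun i => t i ≠ 0), t j ≤ ∑ i, min (t i) (t j) := by
            refine (Finset.sum_le_sum fun i hi => le_min (hmin i hi) le_rfl).trans ?_
            exact Finset.sum_le_univ_sum_of_nonneg fun i => le_min (ht i) hj0.le
          rw [Finset.sum_const, nsmul_eq_mul] at h1
          have h2 : (k : ℝ) * t j ≤ (Finset.univ.filter fun i => t i ≠ 0).card * t j := by
            gcongr
          simp only [sub_nonneg]
          exact h2.trans h1)
    have hτ0 : 0 < τ := hj0.trans_le hτ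
    refine ⟨τ, fun i => min (t i) τ / τ, hτ0.le, fun i => div_nonneg (le_min (ht i) hτ0.le) hτ0.le,
      fun i => (div_le_one hτ0).mpr (min_le_right _ _), ?_, fun i => ?_, fun i hi => ?_⟩
    · rw [← Finset.sum_div, div_eq_iff hτ0.ne']
      simpa [sub_eq_zero] using hzero
    · rw [div_mul_eq_mul_div, min_mul_max, mul_div_cancel_right₀ _ hτ0.ne']
    · have : τ < t i := by simpa using hi
      dsimp only
      rw [min_eq_right this.le, div_self hτ0.ne']

lemma sInf_sum_sq_div_le {m k : ℕ} (hk : 1 ≤ k) (hkm : k ≤ m) {t l s : Fin m → ℝ}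
    (hl0 : ∀ i, 0 ≤ l i) (hl1 : ∀ i, l i ≤ 1) (hl : ∑ i, l i = k) (hls : ∀ i, l i * s i = t i) :
    sInf {v : ℝ | ∃ lam : Fin m → ℝ, (∀ i, 0 < lam i ∧ lam i ≤ 1) ∧ (∑ i, lam i) = (k : ℝ) ∧
      v = ∑ i, (t i) ^ 2 / lam i} ≤ ∑ i, l i * (s i) ^ 2 := by
  have hm0 : (0 : ℝ) < m := by exact_mod_cast (by omega : 0 < m)
  have hk0 : (0 : ℝ) < k := by exact_mod_cast hk
  have hkm' : (k : ℝ) / m ≤ 1 := (div_le_one hm0).mpr (by exact_mod_cast hkm)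
  have hkm0 : 0 < (k : ℝ) / m := div_pos hk0 hm0
  set I := sInf {v : ℝ | ∃ lam : Fin m → ℝ, (∀ i, 0 < lam i ∧ lam i ≤ 1) ∧
    (∑ i, lam i) = (k : ℝ) ∧ v = ∑ i, (t i) ^ 2 / lam i} with hI
  have hstep : ∀ ε ∈ Set.Ioo (0 : ℝ) 1, (1 - ε) * I ≤ ∑ i, l i * (s i) ^ 2 := by
    rintro ε ⟨h0, h1⟩
    have hpos : ∀ i, 0 < (1 - ε) * l i + ε * (k / m) := fun i =>
      add_pos_of_nonneg_of_pos (mul_nonneg (by linarith) (hl0 i)) (mul_pos h0 hkm0)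
    have hIle : I ≤ ∑ i, (t i) ^ 2 / ((1 - ε) * l i + ε * (k / m)) := by
      refine csInf_le ⟨0, ?_⟩ ⟨fun i => (1 - ε) * l i + ε * (k / m), fun i => ⟨hpos i, ?_⟩, ?_, rfl⟩
      · rintro _ ⟨lam, hlam, -, rfl⟩
        exact Finset.sum_nonneg fun i _ => div_nonneg (sq_nonneg _) (hlam i).1.le
      · nlinarith [hl1 i]
      · rw [Finset.sum_add_distrib, ← Finset.mul_sum, hl]
        simp only [Finset.sum_const, Finset.card_univ, Fintype.card_fin, nsmul_eq_mul]
        field_simp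
        ring
    refine (mul_le_mul_of_nonneg_left hIle (by linarith)).trans ?_
    rw [Finset.mul_sum]
    refine Finset.sum_le_sum fun i _ => ?_
    rw [← mul_div_assoc, div_le_iff₀ (hpos i), ← hls i]
    have : 0 ≤ l i * s i ^ 2 * (ε * (k / m)) :=
      mul_nonneg (mul_nonneg (hl0 i) (sq_nonneg _)) (mul_pos h0 hkm0).le
    nlinarith
  have hlim : Filter.Tendsto (fun ε : ℝ => (1 - ε) * I) (nhdsWithin 0 (Set.Ioi 0)) (nhds I) := by
    have : Filter.Tendsto (fun ε : ℝ => (1 - ε) * I) (nhds 0) (nhds ((1 - 0) * I)) :=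
      Continuous.tendsto (by fun_prop) 0
    rw [sub_zero, one_mul] at this
    exact this.mono_left nhdsWithin_le_nhds
  refine le_of_tendsto hlim ?_
  filter_upwards [Ioo_mem_nhdsGT (zero_lt_one' ℝ)] with ε hε using hstep ε hε

/-- For a function `g` with `τ ≤ g`, the weighted sum of `g` over weights `l` in the hypersimplex
that saturate wherever `τ < g` is the largest possible. -/
lemma sum_mul_eq_of_saturated {ι : Type*} [Fintype ι] {k τ : ℝ} {l g : ι → ℝ}
    (hl : ∑ i, l i = k) (hg : ∀ i, τ ≤ g i) (hsat : ∀ i, τ < g i → l i = 1) :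
    ∑ i, l i * g i = k * τ + ∑ i, (g i - τ) := by
  rw [← hl, Finset.sum_mul, ← Finset.sum_add_distrib]
  refine Finset.sum_congr rfl fun i _ => ?_
  rcases (hg i).lt_or_eq with h | h
  · rw [hsat i h]; ring
  · rw [← h]; ring

lemma sum_mul_le_of_le {ι : Type*} [Fintype ι] {k τ : ℝ} {l g : ι → ℝ}
    (hl1 : ∀ i, l i ≤ 1) (hl : ∑ i, l i ≤ k) (hτ : 0 ≤ τ) (hg : ∀ i, τ ≤ g i) :
    ∑ i, l i * g i ≤ k * τ + ∑ i, (g i - τ) := by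
  refine le_trans ?_ (add_le_add_left (mul_le_mul_of_nonneg_right hl hτ) _)
  rw [Finset.sum_mul, ← Finset.sum_add_distrib]
  refine Finset.sum_le_sum fun i _ => ?_
  nlinarith [hl1 i, hg i]

/-- The biconjugate of `Ω + δ_{b△^m}`, with `Ω = ½‖·‖₂² + δ_{B_k}`, is the squared
`k`-support norm on the scaled simplex `b△^m` and `+∞` outside of it. -/
theorem biconjSimplex_OmegaSparse {m k : ℕ} (hm : 1 ≤ m) (hk : 1 ≤ k) (hkm : k ≤ m)
    (b : ℝ) (hb : 0 < b) :
    ∀ t : Fin m → ℝ,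
      (((∀ i, 0 ≤ t i) ∧ ∑ i, t i = b) →
        biconjSimplex (OmegaSparse m k) b t = ((Psi m k t : ℝ) : EReal)) ∧
      (¬ ((∀ i, 0 ≤ t i) ∧ ∑ i, t i = b) →
        biconjSimplex (OmegaSparse m k) b t = ⊤) := by
  intro t
  refine ⟨?_, biconjSimplex_OmegaSparse_eq_top⟩
  rintro ⟨ht0, htb⟩
  obtain ⟨τ, l, hτ, hl0, hl1, hl, hlt, hsat⟩ := exists_optimal_weights hk hkm ht0
  set s : Fin m → ℝ := fun i => max (t i) τ with hs
  have hsτ : ∀ i, τ ≤ s i := fun i => le_max_right _ _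
  have hs0 : ∀ i, 0 ≤ s i := fun i => hτ.trans (hsτ i)
  have hsτ2 : ∀ i, τ ^ 2 ≤ s i ^ 2 := fun i => pow_le_pow_left₀ hτ (hsτ i) 2
  have hsat2 : ∀ i, τ ^ 2 < s i ^ 2 → l i = 1 := fun i h =>
    hsat i (lt_of_pow_lt_pow_left₀ 2 (hs0 i) h)
  set V := ∑ i, l i * s i ^ 2 with hV
  have hVeq : V = k * τ ^ 2 + ∑ i, (s i ^ 2 - τ ^ 2) := sum_mul_eq_of_saturated hl hsτ2 hsat2
  have hPsi : Psi m k t = 1 / 2 * V := by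
    unfold Psi
    congr 1
    refine le_antisymm (sInf_sum_sq_div_le hk hkm hl0 hl1 hl hlt) (le_csInf ?_ ?_)
    · have hm0 : (0 : ℝ) < m := by exact_mod_cast hm
      refine ⟨_, fun _ => (k : ℝ) / m, fun _ => ⟨div_pos (by exact_mod_cast hk) hm0,
        (div_le_one hm0).mpr (by exact_mod_cast hkm)⟩, ?_, rfl⟩
      simp only [Finset.sum_const, Finset.card_univ, Fintype.card_fin, nsmul_eq_mul]
      field_simp
    · rintro _ ⟨lam, hlam, hlamk, rfl⟩
      have h1 : ∑ i, lam i * s i ^ 2 ≤ V :=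
        hVeq ▸ sum_mul_le_of_le (fun i => (hlam i).2) hlamk.le (sq_nonneg τ) hsτ2
      have h2 : ∑ i, (2 * (l i * s i ^ 2) - lam i * s i ^ 2) ≤ ∑ i, t i ^ 2 / lam i := by
        refine Finset.sum_le_sum fun i _ => ?_
        rw [le_div_iff₀ (hlam i).1, ← hlt i]
        change _ ≤ (l i * s i) ^ 2
        nlinarith [sq_nonneg (l i * s i - lam i * s i)]
      rw [Finset.sum_sub_distrib, ← Finset.mul_sum] at h2
      linarith
  rw [hPsi]
  refine le_antisymm (biconjSimplex_le fun r => ?_) ?_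
  · obtain ⟨S, hSk, hAS, hle⟩ := exists_card_eq_sum_mul_le hl0 hl1 hl (fun i => r i * s i)
    have hind : ∑ i, (if i ∈ S then (1 : ℝ) else 0) = k := by simp [hSk]
    have hu : ∀ i, (if i ∈ S then s i else 0) = (if i ∈ S then 1 else 0) * s i := fun i => by simp
    have husum : ∑ i, (if i ∈ S then s i else 0) = b := by
      simp only [hu]
      rw [sum_mul_eq_of_saturated hind hsτ (fun i h => by simp [hAS i (hsat i h)]),
        ← sum_mul_eq_of_saturated hl hsτ hsat, ← htb]
      exact Finset.sum_congr rfl fun i _ => hlt i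
    have husq : ∑ i, (if i ∈ S then s i else 0) ^ 2 = V := by
      rw [hVeq, ← sum_mul_eq_of_saturated hind hsτ2 (fun i h => by simp [hAS i (hsat2 i h)])]
      exact Finset.sum_congr rfl fun i _ => by split_ifs <;> simp
    refine le_trans ?_ (le_iSup _ (⟨fun i => if i ∈ S then s i else 0, fun i => by
      dsimp only
      split_ifs
      exacts [hs0 i, le_rfl], husum⟩ : {t : Fin m → ℝ // (∀ i, 0 ≤ t i) ∧ ∑ i, t i = b}))
    have hcard : (Finset.univ.filter fun i => (if i ∈ S then s i else 0) ≠ 0).card ≤ k := by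
      refine hSk ▸ Finset.card_le_card fun i hi => ?_
      by_contra h
      simp [h] at hi
    have hdot : dotp r t ≤ dotp r (fun i => if i ∈ S then s i else 0) := by
      have : dotp r t = ∑ i, l i * (r i * s i) :=
        Finset.sum_congr rfl fun i _ => by rw [← hlt i]; ring
      rw [this]
      simpa [dotp] using hle
    simp only [OmegaSparse]
    rw [if_pos hcard, husq, ← EReal.coe_sub]
    exact_mod_cast sub_le_sub_right hdot _
  · have hst : dotp s t = V := Finset.sum_congr rfl fun i _ => by rw [← hlt i]; ring
    have := le_biconjSimplex (Ω := OmegaSparse m k) (b := b) (c := 1 / 2 * V) s t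
      (conjSimplex_OmegaSparse_le fun u _ _ hu => ?_)
    · rw [hst] at this
      convert this using 2
      ring
    · have h1 : ∑ i, (if u i ≠ 0 then 1 else 0) * s i ^ 2 ≤ V := by
        rw [hVeq]
        refine sum_mul_le_of_le (fun i => by split_ifs <;> norm_num) ?_ (sq_nonneg τ) hsτ2
        rw [Finset.sum_boole]
        exact_mod_cast hu
      have h2 : ∑ i, (s i * u i - 1 / 2 * u i ^ 2) ≤
          ∑ i, 1 / 2 * ((if u i ≠ 0 then 1 else 0) * s i ^ 2) := by
        refine Finset.sum_le_sum fun i _ => ?_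
        by_cases h : u i = 0
        · simp [h]
        · simp only [ne_eq, h, not_false_eq_true, if_true]
          nlinarith [sq_nonneg (s i - u i)]
      rw [Finset.sum_sub_distrib, ← Finset.mul_sum, ← Finset.mul_sum] at h2
      unfold dotp
      linarith

end
end

section
/- Let m ≥ 1 and 1 ≤ k ≤ m. For every t ∈ ℝ^m with t ≥ 0 componentwise and at most k nonzero entries, the squared k-support norm reduces to half the squared Euclidean norm: Ψ(t) = ½ Σ_{i=1}^m t_i². -/
open scoped BigOperators Classical

noncomputable section

/-- Mixing the indicator of a `k`-element set containing the support of `t` with the constant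
weight `k / m` gives an admissible weight, whose objective value is a multiple of `∑ i, t i ^ 2`. -/
lemma exists_weight_sum_sq_div_eq {m k : ℕ} (hk : 1 ≤ k) (hkm : k ≤ m) (t : Fin m → ℝ)
    (htk : (Finset.univ.filter (fun i => t i ≠ 0)).card ≤ k)
    {ε : ℝ} (hε0 : 0 < ε) (hε1 : ε ≤ 1) :
    ∃ lam : Fin m → ℝ, (∀ i, 0 < lam i ∧ lam i ≤ 1) ∧ (∑ i, lam i) = (k : ℝ) ∧
      (∑ i, (t i) ^ 2) / (1 - ε + ε * (k / m)) = ∑ i, (t i) ^ 2 / lam i := by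
  obtain ⟨S, hS, -, hSk⟩ := Finset.exists_subsuperset_card_eq
    (Finset.subset_univ (Finset.univ.filter (fun i => t i ≠ 0))) htk (by simpa using hkm)
  have hk' : (0 : ℝ) < k := by exact_mod_cast hk
  have hm : (0 : ℝ) < m := by exact_mod_cast hk.trans hkm
  have hc0 : 0 < ε * (k / m : ℝ) := by positivity
  have hc1 : (k / m : ℝ) ≤ 1 := (div_le_one hm).2 (by exact_mod_cast hkm)
  have hcε : ε * (k / m : ℝ) ≤ ε := mul_le_of_le_one_right hε0.le hc1
  refine ⟨fun i => (if i ∈ S then 1 - ε else 0) + ε * (k / m), fun i => ?_, ?_, ?_⟩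
  · dsimp only
    split_ifs <;> constructor <;> linarith
  · rw [Finset.sum_add_distrib, Finset.sum_ite_mem, Finset.univ_inter, Finset.sum_const,
      Finset.sum_const, hSk, Finset.card_univ, Fintype.card_fin, nsmul_eq_mul, nsmul_eq_mul]
    field_simp
    ring
  · rw [Finset.sum_div]
    refine Finset.sum_congr rfl fun i _ => ?_
    by_cases hi : i ∈ S
    · simp [hi]
    · have hti : t i = 0 := by
        by_contra h
        exact hi (hS (by simpa using h))
      simp [hti]

/-- On non-negative `k`-sparse vectors, the squared `k`-support norm reduces to half the
squared Euclidean norm. -/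
theorem Psi_eq_half_sq_norm {m k : ℕ} (hm : 1 ≤ m) (hk : 1 ≤ k) (hkm : k ≤ m)
    (t : Fin m → ℝ) (ht0 : ∀ i, 0 ≤ t i)
    (htk : (Finset.univ.filter (fun i => t i ≠ 0)).card ≤ k) :
    Psi m k t = (1 / 2) * ∑ i, (t i) ^ 2 := by
  rw [Psi]
  congr 1
  refine IsGLB.csInf_eq ⟨?_, fun b hb => ?_⟩ ?_
  · rintro _ ⟨lam, hlam, -, rfl⟩
    exact Finset.sum_le_sum fun i _ => le_div_self (sq_nonneg _) (hlam i).1 (hlam i).2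
  · have hlim : Filter.Tendsto (fun ε : ℝ => (∑ i, (t i) ^ 2) / (1 - ε + ε * (k / m)))
        (nhdsWithin 0 (Set.Ioi 0)) (nhds (∑ i, (t i) ^ 2)) := by
      have h : ContinuousAt (fun ε : ℝ => (∑ i, (t i) ^ 2) / (1 - ε + ε * (k / m))) 0 :=
        ContinuousAt.div (by fun_prop) (by fun_prop) (by simp)
      simpa using h.tendsto.mono_left nhdsWithin_le_nhds
    refine ge_of_tendsto hlim ?_
    filter_upwards [Ioc_mem_nhdsGT (zero_lt_one (α := ℝ))] with ε hε
    exact hb (exists_weight_sum_sq_div_eq hk hkm t htk hε.1 hε.2)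
  · exact ⟨_, exists_weight_sum_sq_div_eq hk hkm t htk zero_lt_one le_rfl⟩

end
end

section
/- Let m ≥ 1 and 1 ≤ k ≤ m. For every a ∈ ℝ^m, the sum of the k largest entries of a admits the variational representation: max_{A ⊆ Fin m, |A| = k} Σ_{i ∈ A} a_i = inf_{v ∈ ℝ} ( k·v + Σ_{i=1}^m [a_i − v]₊ ), and the infimum is attained. -/
open scoped BigOperators Classical

noncomputable section

/-- Variational representation of the sum of the `k` largest entries:
`max_{|A|=k} Σ_{i∈A} a_i = inf_v (k v + Σ_i [a_i − v]₊)`, and the infimum is attained,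
i.e. the sum of the `k` largest entries is the least element of the range of
`v ↦ k v + Σ_i [a_i − v]₊`. -/
theorem kLargestSum_variational {m k : ℕ} (hm : 1 ≤ m) (hk : 1 ≤ k) (hkm : k ≤ m)
    (a : Fin m → ℝ) :
    IsLeast (Set.range (fun v : ℝ => (k : ℝ) * v + ∑ i, max (a i - v) 0))
      (kLargestSum k hkm a) := by
  have sum_le : ∀ A : Finset (Fin m), A.card = k → ∀ v : ℝ,
      ∑ i ∈ A, a i ≤ (k : ℝ) * v + ∑ i, max (a i - v) 0 := by
    intro A hA v
    calc ∑ i ∈ A, a i = (k : ℝ) * v + ∑ i ∈ A, (a i - v) := by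
          simp [Finset.sum_sub_distrib, hA]
      _ ≤ (k : ℝ) * v + ∑ i ∈ A, max (a i - v) 0 := by
          gcongr
          exact le_max_left _ _
      _ ≤ (k : ℝ) * v + ∑ i, max (a i - v) 0 := by
          gcongr
          exact Finset.subset_univ A
  refine ⟨?_, ?_⟩
  · obtain ⟨A, hA, hmax⟩ := Finset.exists_mem_eq_sup'
      (Finset.powersetCard_nonempty.mpr (by simpa using hkm) :
        (Finset.powersetCard k (Finset.univ : Finset (Fin m))).Nonempty)
      (fun A => ∑ i ∈ A, a i)
    have hcard : A.card = k := (Finset.mem_powersetCard.mp hA).2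
    obtain ⟨p, hp, hpmin⟩ := A.exists_min_image a (Finset.card_pos.mp (by omega))
    have outside : ∀ j ∉ A, a j ≤ a p := by
      intro j hj
      have hj' : j ∉ A.erase p := fun h => hj (Finset.mem_of_mem_erase h)
      have hB : insert j (A.erase p) ∈
          Finset.powersetCard k (Finset.univ : Finset (Fin m)) := by
        refine Finset.mem_powersetCard.mpr ⟨Finset.subset_univ _, ?_⟩
        rw [Finset.card_insert_of_notMem hj', Finset.card_erase_of_mem hp]
        omega
      have hle := Finset.le_sup' (fun A => ∑ i ∈ A, a i) hB
      rw [hmax] at hle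
      simp only [Finset.sum_insert hj'] at hle
      linarith [Finset.add_sum_erase A a hp]
    refine ⟨a p, ?_⟩
    have hsum : ∑ i, max (a i - a p) 0 = ∑ i ∈ A, (a i - a p) := by
      rw [← Finset.sum_subset (Finset.subset_univ A)
        fun j _ hj => max_eq_right (sub_nonpos.mpr (outside j hj))]
      exact Finset.sum_congr rfl fun i hi => max_eq_left (sub_nonneg.mpr (hpmin i hi))
    unfold kLargestSum
    rw [hmax]
    simp [hsum, Finset.sum_sub_distrib, hcard]
  · rintro _ ⟨v, rfl⟩
    exact Finset.sup'_le _ _ fun A hA => sum_le A (Finset.mem_powersetCard.mp hA).2 v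

end
end

section
/- Let m ≥ 1 and b > 0. For every s ∈ ℝ^m, the maximum of ⟨s,t⟩ − ½‖t‖₂² over the scaled simplex b△^m admits the dual representation: sup_{t ∈ b△^m} ⟨s,t⟩ − ½‖t‖₂² = inf_{θ ∈ ℝ} ( ½ Σ_{i=1}^m [s_i − θ]₊² + θ·b ), and the infimum is attained at any θ satisfying Σ_{i=1}^m [s_i − θ]₊ = b. -/
open scoped BigOperators Classical

noncomputable section

/-- Weak duality between the quadratic maximization over the scaled simplex and its
one-dimensional dual. -/
lemma simplex_weak_duality {ι : Type*} [Fintype ι] {b : ℝ} (s : ι → ℝ) {t : ι → ℝ}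
    (ht : ∀ i, 0 ≤ t i) (hsum : ∑ i, t i = b) (θ : ℝ) :
    ∑ i, s i * t i - (1 / 2) * ∑ i, (t i) ^ 2 ≤
      (1 / 2) * ∑ i, (max (s i - θ) 0) ^ 2 + θ * b := by
  rw [← hsum, Finset.mul_sum, Finset.mul_sum, Finset.mul_sum, ← Finset.sum_sub_distrib,
    ← Finset.sum_add_distrib]
  refine Finset.sum_le_sum fun i _ => ?_
  nlinarith [mul_le_mul_of_nonneg_right (le_max_left (s i - θ) 0) (ht i),
    sq_nonneg (max (s i - θ) 0 - t i)]

/-- The primal and dual objectives agree at the soft-thresholded point. -/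
lemma simplex_duality_eq {ι : Type*} [Fintype ι] {b : ℝ} (s : ι → ℝ) {θ : ℝ}
    (hsum : ∑ i, max (s i - θ) 0 = b) :
    (1 / 2) * ∑ i, (max (s i - θ) 0) ^ 2 + θ * b =
      ∑ i, s i * max (s i - θ) 0 - (1 / 2) * ∑ i, (max (s i - θ) 0) ^ 2 := by
  rw [← hsum, Finset.mul_sum, Finset.mul_sum, ← Finset.sum_sub_distrib,
    ← Finset.sum_add_distrib]
  refine Finset.sum_congr rfl fun i _ => ?_
  rcases max_cases (s i - θ) 0 with ⟨h, _⟩ | ⟨h, _⟩ <;> rw [h] <;> ring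

/-- A threshold at which the positive parts sum to a prescribed nonnegative number exists. -/
lemma exists_sum_max_sub_eq {ι : Type*} [Fintype ι] [Nonempty ι] {b : ℝ} (hb : 0 ≤ b)
    (s : ι → ℝ) : ∃ θ : ℝ, ∑ i, max (s i - θ) 0 = b := by
  obtain ⟨i₀⟩ := ‹Nonempty ι›
  have hcont : Continuous fun θ : ℝ => ∑ i, max (s i - θ) 0 := by fun_prop
  refine mem_range_of_exists_le_of_exists_ge hcont ⟨∑ i, |s i|, ?_⟩ ⟨s i₀ - b, ?_⟩
  · refine le_trans (Finset.sum_nonpos fun i _ => max_le ?_ le_rfl) hb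
    have := Finset.single_le_sum (fun j _ => abs_nonneg (s j)) (Finset.mem_univ i)
    linarith [le_abs_self (s i)]
  · calc b ≤ max (s i₀ - (s i₀ - b)) 0 := le_max_of_le_left (by linarith)
      _ ≤ _ := Finset.single_le_sum (f := fun i => max (s i - (s i₀ - b)) 0)
        (fun i _ => le_max_right _ _) (Finset.mem_univ i₀)

/-- Dual representation of the maximum of `⟨s,t⟩ − ½‖t‖₂²` over the scaled simplex
`b△^m`: it equals `inf_θ (½ Σ_i [s_i − θ]₊² + θ b)`, and the infimum is attained at
any `θ` satisfying `Σ_i [s_i − θ]₊ = b`. -/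
theorem simplex_conjugate_dual_representation {m : ℕ} (hm : 1 ≤ m) (b : ℝ) (hb : 0 < b)
    (s : Fin m → ℝ) :
    IsLUB {v : ℝ | ∃ t : Fin m → ℝ, (∀ i, 0 ≤ t i) ∧ (∑ i, t i = b) ∧
        v = ∑ i, s i * t i - (1 / 2) * ∑ i, (t i) ^ 2}
      (sInf (Set.range (fun θ : ℝ => (1 / 2) * ∑ i, (max (s i - θ) 0) ^ 2 + θ * b))) ∧
    ∀ θ : ℝ, (∑ i, max (s i - θ) 0 = b) →
      IsLeast (Set.range (fun θ' : ℝ => (1 / 2) * ∑ i, (max (s i - θ') 0) ^ 2 + θ' * b))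
        ((1 / 2) * ∑ i, (max (s i - θ) 0) ^ 2 + θ * b) := by
  have hleast : ∀ θ : ℝ, (∑ i, max (s i - θ) 0 = b) →
      IsLeast (Set.range (fun θ' : ℝ => (1 / 2) * ∑ i, (max (s i - θ') 0) ^ 2 + θ' * b))
        ((1 / 2) * ∑ i, (max (s i - θ) 0) ^ 2 + θ * b) := by
    refine fun θ hθ => ⟨⟨θ, rfl⟩, ?_⟩
    rintro _ ⟨θ', rfl⟩
    rw [simplex_duality_eq s hθ]
    exact simplex_weak_duality s (fun i => le_max_right _ _) hθ θ'
  refine ⟨?_, hleast⟩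
  have : Nonempty (Fin m) := ⟨⟨0, hm⟩⟩
  obtain ⟨θ, hθ⟩ := exists_sum_max_sub_eq hb.le s
  rw [(hleast θ hθ).csInf_eq]
  refine IsGreatest.isLUB ⟨⟨_, fun i => le_max_right _ _, hθ, simplex_duality_eq s hθ⟩, ?_⟩
  rintro _ ⟨t, ht, hsum, rfl⟩
  exact simplex_weak_duality s ht hsum θ

end
end

section
/- Let m, n ≥ 1, γ > 0, and let Ω(t) := (γ/2)‖t‖₂² + δ_{B_1}(t). Then for all a ∈ △^m, b ∈ △^n and all C ∈ ℝ^{m×n} with non-negative entries, the sparsity-constrained dual and semi-dual with k = 1 reduce to unregularized optimal transport shifted by a constant: D_Ω(a,b,C) = S_Ω(a,b,C) = P_0(a,b,C) + (γ/2)‖b‖₂², where P_0 is the unregularized optimal transport value. -/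
open scoped BigOperators Classical

noncomputable section

/-- The `1`-sparse quadratic regularizer `Ω(t) = (γ/2)‖t‖₂² + δ_{B_1}(t)`. -/
def OmegaTop1 (m : ℕ) (γ : ℝ) (t : Fin m → ℝ) : EReal :=
  if (Finset.univ.filter (fun i => t i ≠ 0)).card ≤ 1 then
    ((γ / 2 * ∑ i, (t i) ^ 2 : ℝ) : EReal)
  else ⊤

/-- The unregularized optimal transport value `P_0(a,b,C)`. -/
def primalUnreg {m n : ℕ} (a : Fin m → ℝ) (b : Fin n → ℝ)
    (C : Fin m → Fin n → ℝ) : EReal :=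
  ⨅ T : {T : Fin m → Fin n → ℝ //
      (∀ i j, 0 ≤ T i j) ∧ (∀ i, ∑ j, T i j = a i) ∧ (∀ j, ∑ i, T i j = b j)},
    ((∑ i, ∑ j, C i j * T.1 i j : ℝ) : EReal)

theorem EReal.coe_finset_sum_real {ι : Type*} (s : Finset ι) (f : ι → ℝ) :
    ((∑ i ∈ s, f i : ℝ) : EReal) = ∑ i ∈ s, (f i : EReal) := by
  induction s using Finset.induction_on with
  | empty => simp
  | insert i s hi ih => simp [Finset.sum_insert hi, ih]

theorem ciSup_add_const_of_finite {ι : Type*} [Finite ι] [Nonempty ι] (s : ι → ℝ) (c : ℝ) :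
    ⨆ i, (s i + c) = (⨆ i, s i) + c := by
  refine le_antisymm (ciSup_le fun i => ?_) ?_
  · linarith [le_ciSup (Finite.bddAbove_range s) i]
  · obtain ⟨i, hi⟩ := exists_eq_ciSup_of_finite (f := s)
    rw [← hi]
    exact le_ciSup (Finite.bddAbove_range fun i => s i + c) i

theorem dotp_single {m : ℕ} (s : Fin m → ℝ) (i : Fin m) (x : ℝ) :
    dotp s (Pi.single i x) = s i * x := by
  simp [dotp, Pi.single_apply]

theorem OmegaTop1_single {m : ℕ} (γ : ℝ) (i : Fin m) (x : ℝ) :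
    OmegaTop1 m γ (Pi.single i x) = ((γ / 2 * x ^ 2 : ℝ) : EReal) := by
  have hcard : (Finset.univ.filter fun k => (Pi.single i x : Fin m → ℝ) k ≠ 0).card ≤ 1 := by
    rw [Finset.card_le_one]
    intro k hk l hl
    simp only [Finset.mem_filter, Finset.mem_univ, true_and, Pi.single_apply, ne_eq,
      ite_eq_right_iff, Classical.not_imp] at hk hl
    rw [hk.1, hl.1]
  rw [OmegaTop1, if_pos hcard]
  simp [Pi.single_apply, ite_pow]

/-- Outside the vectors with a single nonzero coordinate, `OmegaTop1` is infinite. -/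
theorem OmegaTop1_eq_top_or_eq_single {m : ℕ} [Nonempty (Fin m)] (γ : ℝ) (t : Fin m → ℝ) :
    OmegaTop1 m γ t = ⊤ ∨ ∃ i, t = Pi.single i (t i) := by
  by_cases h : (Finset.univ.filter fun i => t i ≠ 0).card ≤ 1
  · right
    rw [Finset.card_le_one_iff_subset_singleton] at h
    obtain ⟨i, hi⟩ := h
    refine ⟨i, funext fun k => ?_⟩
    by_cases hk : k = i
    · subst hk; simp
    · rw [Pi.single_eq_of_ne hk]
      by_contra hne
      exact hk (by simpa using hi (by simpa using hne))
  · left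
    rw [OmegaTop1, if_neg h]

theorem conjSimplex_OmegaTop1 {m : ℕ} [Nonempty (Fin m)] (γ : ℝ) {b : ℝ} (hb : 0 ≤ b)
    (s : Fin m → ℝ) :
    conjSimplex (OmegaTop1 m γ) b s = ((b * (⨆ i, s i) - γ / 2 * b ^ 2 : ℝ) : EReal) := by
  refine le_antisymm (iSup_le ?_) ?_
  · rintro ⟨t, -, hsum⟩
    obtain h | ⟨i, hi⟩ := OmegaTop1_eq_top_or_eq_single γ t
    · simp [h]
    · have hti : t i = b := by rw [← hsum, hi]; simp
      rw [hti] at hi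
      subst hi
      simp only [dotp_single, OmegaTop1_single]
      rw [← EReal.coe_sub, EReal.coe_le_coe_iff]
      linarith [mul_le_mul_of_nonneg_left (le_ciSup (Finite.bddAbove_range s) i) hb]
  · obtain ⟨i, hi⟩ := exists_eq_ciSup_of_finite (f := s)
    refine le_iSup_of_le ⟨Pi.single i b, fun k => ?_, by simp⟩ ?_
    · exact (Pi.single_nonneg.2 hb : (0 : Fin m → ℝ) ≤ Pi.single i b) k
    · simp only [dotp_single, OmegaTop1_single]
      rw [← EReal.coe_sub, EReal.coe_le_coe_iff, ← hi, mul_comm]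

theorem conjPlus_OmegaTop1 {m : ℕ} [Nonempty (Fin m)] {γ : ℝ} (hγ : 0 < γ) (s : Fin m → ℝ) :
    conjPlus (OmegaTop1 m γ) s = ((max 0 (⨆ i, s i) ^ 2 / (2 * γ) : ℝ) : EReal) := by
  refine le_antisymm (iSup_le ?_) ?_
  · rintro ⟨t, ht⟩
    obtain h | ⟨i, hi⟩ := OmegaTop1_eq_top_or_eq_single γ t
    · simp [h]
    · have hx := ht i
      generalize t i = x at hi hx
      subst hi
      simp only [dotp_single, OmegaTop1_single]
      rw [← EReal.coe_sub, EReal.coe_le_coe_iff, le_div_iff₀ (by positivity)]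
      have hs := mul_le_mul_of_nonneg_left
        ((le_ciSup (Finite.bddAbove_range s) i).trans (le_max_right 0 _)) (mul_nonneg hγ.le hx)
      nlinarith [sq_nonneg (max 0 (⨆ i, s i) - γ * x)]
  · obtain ⟨i, hi⟩ := exists_eq_ciSup_of_finite (f := s)
    refine le_iSup_of_le ⟨Pi.single i (max 0 (s i) / γ), fun k => ?_⟩ ?_
    · exact (Pi.single_nonneg.2 (by positivity) :
        (0 : Fin m → ℝ) ≤ Pi.single i (max 0 (s i) / γ)) k
    · simp only [dotp_single, OmegaTop1_single]
      rw [← EReal.coe_sub, EReal.coe_le_coe_iff, ← hi]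
      apply le_of_eq
      rcases max_cases 0 (s i) with ⟨h, -⟩ | ⟨h, -⟩ <;> rw [h] <;> field_simp <;> ring

/-- The semi-dual objective of unregularized optimal transport. -/
def semiDualObj {m n : ℕ} (a : Fin m → ℝ) (b : Fin n → ℝ) (C : Fin m → Fin n → ℝ)
    (α : Fin m → ℝ) : ℝ :=
  dotp α a - ∑ j, b j * ⨆ i, (α i - C i j)

theorem semiDualVal_OmegaTop1 {m n : ℕ} [Nonempty (Fin m)] (γ : ℝ) (a : Fin m → ℝ)
    {b : Fin n → ℝ} (hb : ∀ j, 0 ≤ b j) (C : Fin m → Fin n → ℝ) :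
    semiDualVal (OmegaTop1 m γ) a b C
      = ⨆ α, ((semiDualObj a b C α + γ / 2 * ∑ j, b j ^ 2 : ℝ) : EReal) := by
  refine iSup_congr fun α => ?_
  simp only [conjSimplex_OmegaTop1 γ (hb _)]
  rw [← EReal.coe_finset_sum_real, ← EReal.coe_sub, Finset.sum_sub_distrib, ← Finset.mul_sum,
    semiDualObj]
  congr 1
  ring

theorem dualVal_OmegaTop1 {m n : ℕ} [Nonempty (Fin m)] {γ : ℝ} (hγ : 0 < γ) (a : Fin m → ℝ)
    (b : Fin n → ℝ) (C : Fin m → Fin n → ℝ) :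
    dualVal (OmegaTop1 m γ) a b C
      = ⨆ α : Fin m → ℝ, ⨆ β : Fin n → ℝ, ((dotp α a + ∑ j, (β j * b j
          - max 0 ((⨆ i, (α i - C i j)) + β j) ^ 2 / (2 * γ)) : ℝ) : EReal) := by
  refine iSup_congr fun α => iSup_congr fun β => ?_
  have hshift : ∀ j, ⨆ i, (α i + β j - C i j) = (⨆ i, (α i - C i j)) + β j := fun j => by
    rw [← ciSup_add_const_of_finite]
    exact iSup_congr fun i => by ring
  simp only [conjPlus_OmegaTop1 hγ, hshift]
  rw [← EReal.coe_finset_sum_real, ← EReal.coe_add, ← EReal.coe_sub, Finset.sum_sub_distrib]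
  simp only [dotp, add_sub_assoc]

theorem dualVal_eq_semiDualVal_OmegaTop1 {m n : ℕ} [Nonempty (Fin m)] {γ : ℝ} (hγ : 0 < γ)
    (a : Fin m → ℝ) {b : Fin n → ℝ} (hb : ∀ j, 0 ≤ b j) (C : Fin m → Fin n → ℝ) :
    dualVal (OmegaTop1 m γ) a b C = semiDualVal (OmegaTop1 m γ) a b C := by
  rw [dualVal_OmegaTop1 hγ, semiDualVal_OmegaTop1 γ a hb]
  refine iSup_congr fun α => ?_
  have key : semiDualObj a b C α + γ / 2 * ∑ j, b j ^ 2
      = dotp α a + ∑ j, (γ / 2 * b j ^ 2 - b j * ⨆ i, (α i - C i j)) := by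
    rw [semiDualObj, Finset.sum_sub_distrib, ← Finset.mul_sum]
    ring
  rw [key]
  refine le_antisymm (iSup_le fun β => ?_) ?_
  · rw [EReal.coe_le_coe_iff]
    refine add_le_add le_rfl (Finset.sum_le_sum fun j _ => ?_)
    generalize (⨆ i, (α i - C i j)) = M
    rw [sub_le_iff_le_add, ← sub_le_iff_le_add', le_div_iff₀ (by positivity)]
    have h := mul_le_mul_of_nonneg_left (le_max_right 0 (M + β j)) (mul_nonneg hγ.le (hb j))
    nlinarith [sq_nonneg (max 0 (M + β j) - γ * b j)]
  · refine le_iSup_of_le (fun j => γ * b j - ⨆ i, (α i - C i j)) ?_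
    rw [EReal.coe_le_coe_iff]
    refine add_le_add le_rfl (Finset.sum_le_sum fun j _ => ?_)
    rw [add_sub_cancel, max_eq_right (mul_nonneg hγ.le (hb j))]
    apply le_of_eq
    field_simp
    ring

/-- Weak duality for unregularized optimal transport. -/
theorem semiDualObj_le_cost {m n : ℕ} (a : Fin m → ℝ) (b : Fin n → ℝ)
    (C : Fin m → Fin n → ℝ) (α : Fin m → ℝ) {T : Fin m → Fin n → ℝ} (hT : ∀ i j, 0 ≤ T i j)
    (hrow : ∀ i, ∑ j, T i j = a i) (hcol : ∀ j, ∑ i, T i j = b j) :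
    semiDualObj a b C α ≤ ∑ i, ∑ j, C i j * T i j := by
  have h : ∑ j, ∑ i, (α i - C i j) * T i j ≤ ∑ j, b j * ⨆ i, (α i - C i j) := by
    gcongr with j
    rw [← hcol j, Finset.sum_mul]
    refine Finset.sum_le_sum fun i _ => ?_
    rw [mul_comm]
    exact mul_le_mul_of_nonneg_left
      (le_ciSup (Finite.bddAbove_range fun i => α i - C i j) i) (hT i j)
  rw [Finset.sum_comm] at h
  simp only [sub_mul, Finset.sum_sub_distrib, ← Finset.mul_sum, hrow] at h
  rw [semiDualObj, dotp]
  linarith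

theorem StrongDual.apply_pi_prod {m : ℕ} (f : StrongDual ℝ ((Fin m → ℝ) × ℝ)) (x : Fin m → ℝ)
    (y : ℝ) :
    f (x, y) = dotp (fun i => f (Pi.single i 1, 0)) x + f (0, 1) * y := by
  have hx : f (x, 0) = dotp (fun i => f (Pi.single i 1, 0)) x := by
    have := LinearMap.pi_apply_eq_sum_univ
      ((f : ((Fin m → ℝ) × ℝ) →ₗ[ℝ] ℝ) ∘ₗ LinearMap.inl ℝ (Fin m → ℝ) ℝ) x
    simp only [LinearMap.comp_apply, LinearMap.inl_apply, smul_eq_mul,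
      ContinuousLinearMap.coe_coe] at this
    rw [this, dotp]
    refine Finset.sum_congr rfl fun i _ => ?_
    rw [mul_comm]
    congr 3
    ext k
    simp [Pi.single_apply, eq_comm]
  have hy : f (0, y) = f (0, 1) * y := by
    have : ((0 : Fin m → ℝ), y) = y • ((0 : Fin m → ℝ), (1 : ℝ)) := by simp
    rw [this, map_smul, smul_eq_mul, mul_comm]
  rw [← hx, ← hy, ← map_add]
  simp

/-- Strong duality for unregularized optimal transport: every strict lower bound of the
transport costs is at most some value of the semi-dual objective. -/
theorem exists_le_semiDualObj {m n : ℕ} [Nonempty (Fin m)] {a : Fin m → ℝ} {b : Fin n → ℝ}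
    (hb : ∀ j, 0 ≤ b j) (C : Fin m → Fin n → ℝ) {T₀ : Fin m → Fin n → ℝ}
    (hT₀ : ∀ i j, 0 ≤ T₀ i j) (hrow₀ : ∀ i, ∑ j, T₀ i j = a i)
    (hcol₀ : ∀ j, ∑ i, T₀ i j = b j) {r : ℝ}
    (hr : ∀ T : Fin m → Fin n → ℝ, (∀ i j, 0 ≤ T i j) → (∀ i, ∑ j, T i j = a i) →
      (∀ j, ∑ i, T i j = b j) → r < ∑ i, ∑ j, C i j * T i j) :
    ∃ α, r ≤ semiDualObj a b C α := by
  let K : Set (Fin m → Fin n → ℝ) := {T | (∀ i j, 0 ≤ T i j) ∧ ∀ j, ∑ i, T i j = b j}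
  let L : (Fin m → Fin n → ℝ) →ₗ[ℝ] (Fin m → ℝ) × ℝ :=
    { toFun := fun T => (fun i => ∑ j, T i j, ∑ i, ∑ j, C i j * T i j)
      map_add' := fun S T => by
        ext <;> simp [Finset.sum_add_distrib, mul_add]
      map_smul' := fun c T => by
        ext <;> simp [Finset.mul_sum, mul_left_comm] }
  have hK_convex : Convex ℝ K := by
    rintro S ⟨hS, hS'⟩ T ⟨hT, hT'⟩ p q hp hq hpq
    refine ⟨fun i j => ?_, fun j => ?_⟩
    · exact add_nonneg (mul_nonneg hp (hS i j)) (mul_nonneg hq (hT i j))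
    · simp only [Pi.add_apply, Pi.smul_apply, smul_eq_mul, Finset.sum_add_distrib,
        ← Finset.mul_sum, hS', hT']
      rw [← add_mul, hpq, one_mul]
  have hK_closed : IsClosed K := by
    simp only [K, Set.ofPred_and, Set.ofPred_forall]
    refine IsClosed.inter ?_ ?_
    · exact isClosed_iInter fun i => isClosed_iInter fun j =>
        isClosed_le (by fun_prop) (by fun_prop)
    · exact isClosed_iInter fun j => isClosed_eq (by fun_prop) (by fun_prop)
  have hK_compact : IsCompact K := by
    refine (isCompact_Icc (a := 0) (b := fun _ : Fin m => b)).of_isClosed_subset hK_closed ?_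
    rintro T ⟨hT, hcol⟩
    refine ⟨hT, fun i j => ?_⟩
    refine le_of_le_of_eq ?_ (hcol j)
    exact Finset.single_le_sum (f := fun i => T i j) (fun i _ => hT i j) (Finset.mem_univ i)
  have hdisj : Disjoint (L '' K) ({a} ×ˢ Set.Iic r) := by
    rw [Set.disjoint_left]
    rintro _ ⟨T, ⟨hT, hcol⟩, rfl⟩ ⟨hrow, hle⟩
    exact (hr T hT (fun i => congrFun hrow i) hcol).not_ge hle
  obtain ⟨f, u, v, hfu, huv, hvf⟩ := geometric_hahn_banach_compact_closed
    (hK_convex.linear_image L) (hK_compact.image L.continuous_of_finiteDimensional)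
    ((convex_singleton a).prod (convex_Iic r)) (isClosed_singleton.prod isClosed_Iic) hdisj
  set g : Fin m → ℝ := fun i => f (Pi.single i 1, 0)
  set c : ℝ := f (0, 1)
  have hsep : ∀ T ∈ K, dotp g (fun i => ∑ j, T i j) + c * ∑ i, ∑ j, C i j * T i j
      < dotp g a + c * r := by
    intro T hT
    have h₁ := hfu _ (Set.mem_image_of_mem L hT)
    have h₂ := hvf (a, r) ⟨rfl, Set.self_mem_Iic⟩
    change f (fun i => ∑ j, T i j, ∑ i, ∑ j, C i j * T i j) < u at h₁
    rw [StrongDual.apply_pi_prod] at h₁ h₂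
    linarith
  have hc_neg : c < 0 := by
    have h := hsep T₀ ⟨hT₀, hcol₀⟩
    simp only [hrow₀] at h
    have h' := hr T₀ hT₀ hrow₀ hcol₀
    by_contra! hc₀
    nlinarith
  refine ⟨fun i => g i / (-c), ?_⟩
  set α : Fin m → ℝ := fun i => g i / (-c)
  have hgα : ∀ x, dotp g x = -c * dotp α x := by
    intro x
    rw [dotp, dotp, Finset.mul_sum]
    refine Finset.sum_congr rfl fun i _ => ?_
    rw [← mul_assoc, mul_div_cancel₀ _ (neg_ne_zero.2 hc_neg.ne)]
  choose k hk using fun j => exists_eq_ciSup_of_finite (f := fun i => α i - C i j)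
  let T : Fin m → Fin n → ℝ := fun i j => if i = k j then b j else 0
  have hT : T ∈ K := by
    refine ⟨fun i j => ?_, fun j => by simp [T]⟩
    dsimp only [T]
    split_ifs
    exacts [hb j, le_rfl]
  have hcost : dotp α (fun i => ∑ j, T i j) - ∑ i, ∑ j, C i j * T i j
      = ∑ j, b j * ⨆ i, (α i - C i j) := by
    simp only [dotp, Finset.mul_sum, ← Finset.sum_sub_distrib, ← sub_mul]
    rw [Finset.sum_comm]
    refine Finset.sum_congr rfl fun j _ => ?_
    rw [← hk j]
    simp [T, mul_comm]
  have h := hsep T hT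
  rw [hgα, hgα] at h
  rw [semiDualObj, ← hcost]
  nlinarith

/-- Limit case `k = 1`: for `Ω(t) = (γ/2)‖t‖₂² + δ_{B_1}(t)`, the dual and semi-dual
both reduce to the unregularized optimal transport value shifted by `(γ/2)‖b‖₂²`. -/
theorem limit_case_top1 {m n : ℕ} (hm : 1 ≤ m) (hn : 1 ≤ n) (γ : ℝ) (hγ : 0 < γ)
    (a : Fin m → ℝ) (ha : (∀ i, 0 ≤ a i) ∧ ∑ i, a i = 1)
    (b : Fin n → ℝ) (hb : (∀ j, 0 ≤ b j) ∧ ∑ j, b j = 1)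
    (C : Fin m → Fin n → ℝ) (hC : ∀ i j, 0 ≤ C i j) :
    dualVal (OmegaTop1 m γ) a b C = semiDualVal (OmegaTop1 m γ) a b C ∧
    semiDualVal (OmegaTop1 m γ) a b C
      = primalUnreg a b C + ((γ / 2 * ∑ j, (b j) ^ 2 : ℝ) : EReal) := by
  have : Nonempty (Fin m) := ⟨⟨0, hm⟩⟩
  refine ⟨dualVal_eq_semiDualVal_OmegaTop1 hγ a hb.1 C, ?_⟩
  rw [semiDualVal_OmegaTop1 γ a hb.1]
  set κ : ℝ := γ / 2 * ∑ j, b j ^ 2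
  refine le_antisymm (iSup_le fun α => ?_) ?_
  · rw [EReal.coe_add]
    gcongr
    refine le_iInf fun T => ?_
    rw [EReal.coe_le_coe_iff]
    exact semiDualObj_le_cost a b C α T.2.1 T.2.2.1 T.2.2.2
  · refine EReal.add_le_of_le_sub (EReal.ge_of_forall_gt_iff_ge.1 fun r hr => ?_)
    obtain ⟨α, hα⟩ := exists_le_semiDualObj (a := a) (T₀ := fun i j => a i * b j) hb.1 C
      (fun i j => mul_nonneg (ha.1 i) (hb.1 j))
      (fun i => by rw [← Finset.mul_sum, hb.2, mul_one])
      (fun j => by rw [← Finset.sum_mul, ha.2, one_mul])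
      (fun T hT hrow hcol => EReal.coe_lt_coe_iff.1
        (hr.trans_le (iInf_le_of_le ⟨T, hT, hrow, hcol⟩ le_rfl)))
    rw [EReal.le_sub_iff_add_le (.inl (EReal.coe_ne_bot _)) (.inl (EReal.coe_ne_top _))]
    refine le_iSup_of_le α ?_
    rw [← EReal.coe_add, EReal.coe_le_coe_iff]
    linarith

end
end

section
/- Let m ≥ 1 and b > 0. Let s ∈ ℝ^m and let θ ∈ ℝ satisfy Σ_{i=1}^m [s_i − θ]₊ = b. Then the maximum of ⟨s,t⟩ − ½‖t‖₂² over the scaled simplex b△^m equals ½ Σ_{i : s_i ≥ θ} (s_i² − θ²), and it is attained at t* with t*_i = [s_i − θ]₊ (the Euclidean projection of s onto b△^m). -/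
open scoped BigOperators Classical

noncomputable section

/-- Projection onto the scaled simplex: if `θ` satisfies `Σ_i [s_i − θ]₊ = b`, then
`t*_i = [s_i − θ]₊` is feasible for `b△^m`, maximizes `⟨s,t⟩ − ½‖t‖₂²` over `b△^m`
(i.e. it is the Euclidean projection of `s` onto `b△^m`), and the maximal value is
`½ Σ_{i : s_i ≥ θ} (s_i² − θ²)`. -/
theorem simplex_projection_value {m : ℕ} (hm : 1 ≤ m) (b : ℝ) (hb : 0 < b)
    (s : Fin m → ℝ) (θ : ℝ) (hθ : ∑ i, max (s i - θ) 0 = b)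
    (tstar : Fin m → ℝ) (htstar : tstar = fun i => max (s i - θ) 0) :
    ((∀ i, 0 ≤ tstar i) ∧ (∑ i, tstar i = b)) ∧
      (∀ t : Fin m → ℝ, (∀ i, 0 ≤ t i) → (∑ i, t i = b) →
        ∑ i, s i * t i - (1 / 2) * ∑ i, (t i) ^ 2 ≤
          ∑ i, s i * tstar i - (1 / 2) * ∑ i, (tstar i) ^ 2) ∧
      ∑ i, s i * tstar i - (1 / 2) * ∑ i, (tstar i) ^ 2 =
        (1 / 2) * ∑ i ∈ Finset.univ.filter (fun i => θ ≤ s i), ((s i) ^ 2 - θ ^ 2) := by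
  subst htstar
  refine ⟨⟨fun i => le_max_right _ _, hθ⟩, fun t ht hsum => ?_, ?_⟩
  · have key : ∑ i, (s i * t i - (1 / 2) * (t i) ^ 2 - θ * t i) ≤
        ∑ i, (s i * max (s i - θ) 0 - (1 / 2) * (max (s i - θ) 0) ^ 2 -
          θ * max (s i - θ) 0) := by
      refine Finset.sum_le_sum fun i _ => ?_
      have hi := ht i
      rcases le_total θ (s i) with h | h
      · rw [max_eq_left (sub_nonneg.2 h)]
        nlinarith [sq_nonneg (s i - θ - t i)]
      · rw [max_eq_right (sub_nonpos.2 h)]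
        nlinarith [mul_nonneg (sub_nonneg.2 h) hi, sq_nonneg (t i)]
    simp only [Finset.sum_sub_distrib, ← Finset.mul_sum, hsum, hθ] at key
    linarith
  · rw [Finset.sum_filter, Finset.mul_sum, Finset.mul_sum, ← Finset.sum_sub_distrib]
    refine Finset.sum_congr rfl fun i _ => ?_
    beta_reduce
    split_ifs with h
    · rw [max_eq_left (sub_nonneg.2 h)]
      ring
    · rw [max_eq_right (sub_nonpos.2 (not_le.1 h).le)]
      ring

end
end
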